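/- For every ε > 0 there exists a constant C > 0 such that for every positive integer N divisible by 4 there exist a positive integer R with R ≥ N/2 − C·N^{113/132 + ε} and an R × N matrix H with all entries in {−1, 1} satisfying H·Hᵀ = N·I_R, where I_R is the R × R identity matrix. Equivalently, r(N) ≥ N/2 + O(N^{113/132 + o(1)}) unconditionally for all N ≡ 0 (mod 4). -/

import Mathlib

namespace PH
open Matrix
open scoped Kronecker

def IsPM {m n : Type*} (H : Matrix m n ℚ) : Prop := ∀ i j, H i j = 1 ∨ H i j = -1

def IsHad (n : ℕ) : Prop :=
  ∃ H : Matrix (Fin n) (Fin n) ℚ, IsPM H ∧ H * Hᵀ = (n : ℚ) • 1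

lemma IsHad.of_fintype {ι : Type*} [Fintype ι] [DecidableEq ι] (n : ℕ) (H : Matrix ι ι ℚ)
    (hc : Fintype.card ι = n) (h1 : IsPM H) (h2 : H * Hᵀ = (n : ℚ) • 1) : IsHad n := by
  subst hc
  let e := Fintype.equivFin ι
  refine ⟨H.submatrix e.symm e.symm, fun i j => h1 _ _, ?_⟩
  rw [transpose_submatrix, Matrix.submatrix_mul_equiv, h2]
  ext i j
  simp [Matrix.one_apply]

lemma IsPM.kronecker {a b c d : Type*} {A : Matrix a b ℚ} {B : Matrix c d ℚ}
    (hA : IsPM A) (hB : IsPM B) : IsPM (A ⊗ₖ B) := by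
  intro i j
  rw [Matrix.kroneckerMap_apply]
  rcases hA i.1 j.1 with h | h <;> rcases hB i.2 j.2 with h' | h' <;> simp [h, h']

lemma IsHad.mul {a b : ℕ} (ha : IsHad a) (hb : IsHad b) : IsHad (a * b) := by
  obtain ⟨A, hA, hA2⟩ := ha
  obtain ⟨B, hB, hB2⟩ := hb
  refine IsHad.of_fintype _ (A ⊗ₖ B) (by simp) (hA.kronecker hB) ?_
  rw [show (A ⊗ₖ B)ᵀ = Aᵀ ⊗ₖ Bᵀ from (kroneckerMap_transpose _ _ _).symm, ← Matrix.mul_kronecker_mul, hA2, hB2]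
  rw [Matrix.smul_kronecker, Matrix.kronecker_smul, Matrix.one_kronecker_one, smul_smul]
  push_cast; rfl

lemma isHad_two : IsHad 2 := by
  refine ⟨!![1, 1; 1, -1], ?_, ?_⟩
  · intro i j; fin_cases i <;> fin_cases j <;> simp
  · ext i j; fin_cases i <;> fin_cases j <;> simp [Matrix.mul_apply, Fin.sum_univ_two] <;> norm_num

lemma isHad_one : IsHad 1 := by
  refine ⟨1, ?_, ?_⟩
  · intro i j; left; simp [Matrix.one_apply, Subsingleton.elim i j]
  · simp

lemma isHad_two_pow (k : ℕ) : IsHad (2 ^ k) := by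
  induction k with
  | zero => exact isHad_one
  | succ k ih => rw [pow_succ]; exact ih.mul isHad_two

/-- combine two Hadamard matrices -/
lemma combine {a b : ℕ} (hab : a ≤ b) (ha : IsHad a) (hb : IsHad b) :
    ∃ H : Matrix (Fin a) (Fin (a + b)) ℤ, (∀ i j, H i j = 1 ∨ H i j = -1) ∧
      H * H.transpose = ((a + b : ℕ) : ℤ) • (1 : Matrix (Fin a) (Fin a) ℤ) := by
  obtain ⟨A, hA, hA2⟩ := ha
  obtain ⟨B, hB, hB2⟩ := hb
  let H : Matrix (Fin a) (Fin (a + b)) ℚ :=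
    fun i j => Fin.addCases (fun j => A i j) (fun j => B (Fin.castLE hab i) j) j
  have hpm : IsPM H := by
    intro i j
    refine Fin.addCases (fun j => ?_) (fun j => ?_) j
    · simpa [H] using hA i j
    · simpa [H] using hB (Fin.castLE hab i) j
  have hH : H * Hᵀ = ((a + b : ℕ) : ℚ) • 1 := by
    ext i j
    rw [Matrix.mul_apply, Fin.sum_univ_add]
    have hl : ∀ i j, H i (Fin.castAdd b j) = A i j := fun i j => Fin.addCases_left j
    have hr : ∀ i j, H i (Fin.natAdd a j) = B (Fin.castLE hab i) j := fun i j => Fin.addCases_right j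
    simp only [Matrix.transpose_apply, hl, hr]
    have e1 := congrFun (congrFun hA2 i) j
    have e2 := congrFun (congrFun hB2 (Fin.castLE hab i)) (Fin.castLE hab j)
    simp only [Matrix.mul_apply, Matrix.transpose_apply] at e1 e2
    rw [e1, e2]
    by_cases h : i = j
    · subst h; simp
    · have : Fin.castLE hab i ≠ Fin.castLE hab j := fun h' => h (Fin.castLE_injective hab h')
      simp [h, this]
  let G : Matrix (Fin a) (Fin (a + b)) ℤ := fun i j => if H i j = 1 then 1 else -1
  have hG : ∀ i j, ((G i j : ℤ) : ℚ) = H i j := by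
    intro i j
    rcases hpm i j with h | h
    · simp [G, h]
    · simp only [G, h]; norm_num
  refine ⟨G, fun i j => ?_, ?_⟩
  · simp only [G]; split_ifs <;> simp
  · ext i j
    have := congrFun (congrFun hH i) j
    simp only [Matrix.mul_apply, Matrix.transpose_apply, ← hG] at this
    have h2 : ((∑ x, G i x * G j x : ℤ) : ℚ) = (((a + b : ℕ) : ℤ) • (1 : Matrix (Fin a) (Fin a) ℤ)) i j := by
      push_cast
      rw [this]
      by_cases h : i = j
      · subst h; simp
      · simp [h]
    rw [Matrix.mul_apply]
    exact_mod_cast h2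

lemma IsHad.toInt {a : ℕ} (ha : IsHad a) :
    ∃ H : Matrix (Fin a) (Fin a) ℤ, (∀ i j, H i j = 1 ∨ H i j = -1) ∧
      H * H.transpose = ((a : ℕ) : ℤ) • (1 : Matrix (Fin a) (Fin a) ℤ) := by
  obtain ⟨H, hpm, hH⟩ := ha
  let G : Matrix (Fin a) (Fin a) ℤ := fun i j => if H i j = 1 then 1 else -1
  have hG : ∀ i j, ((G i j : ℤ) : ℚ) = H i j := by
    intro i j
    rcases hpm i j with h | h
    · simp [G, h]
    · simp only [G, h]; norm_num
  refine ⟨G, fun i j => ?_, ?_⟩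
  · simp only [G]; split_ifs <;> simp
  · ext i j
    have := congrFun (congrFun hH i) j
    simp only [Matrix.mul_apply, Matrix.transpose_apply, ← hG] at this
    have h2 : ((∑ x, G i x * G j x : ℤ) : ℚ) = ((a : ℤ) • (1 : Matrix (Fin a) (Fin a) ℤ)) i j := by
      push_cast
      rw [this]
      by_cases h : i = j
      · subst h; simp
      · simp [h]
    rw [Matrix.mul_apply]
    exact_mod_cast h2

end PH

namespace PH
open Matrix
open scoped Kronecker

/-- all ones matrix -/
def JJ (ι : Type*) : Matrix ι ι ℚ := fun _ _ => 1

lemma JJ_kron (ι κ : Type*) : JJ ι ⊗ₖ JJ κ = JJ (ι × κ) := by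
  ext i j; simp [JJ, Matrix.kroneckerMap_apply]

lemma JJ_transpose (ι : Type*) : (JJ ι)ᵀ = JJ ι := by ext i j; simp [JJ]

structure Quad (ι : Type) [Fintype ι] [DecidableEq ι] (h0 h1 h2 h3 : Matrix ι ι ℚ) : Prop where
  pm0 : IsPM h0
  pm1 : IsPM h1
  pm2 : IsPM h2
  pm3 : IsPM h3
  s0 : h0ᵀ = h0
  s1 : h1ᵀ = h1
  s2 : h2ᵀ = h2
  s3 : h3ᵀ = h3
  m01 : h0 * h1 = JJ ι
  m02 : h0 * h2 = JJ ι
  m12 : h1 * h2 = JJ ι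
  m03 : h0 * h3 = - JJ ι
  m13 : h1 * h3 = - JJ ι
  m23 : h2 * h3 = - JJ ι
  sum : h0 * h0 + h1 * h1 + h2 * h2 + h3 * h3 = (4 * (Fintype.card ι : ℚ)) • 1

lemma flipmul {ι : Type} [Fintype ι] {a b c : Matrix ι ι ℚ} (ha : aᵀ = a) (hb : bᵀ = b)
    (hc : cᵀ = c) (h : a * b = c) : b * a = c := by
  have := congrArg Matrix.transpose h
  rwa [Matrix.transpose_mul, ha, hb, hc] at this

section
variable {ι : Type} [Fintype ι] [DecidableEq ι] {h0 h1 h2 h3 : Matrix ι ι ℚ}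
lemma negJ_tr : (- JJ ι)ᵀ = - JJ ι := by rw [Matrix.transpose_neg, JJ_transpose]
lemma Quad.m10 (h : Quad ι h0 h1 h2 h3) : h1 * h0 = JJ ι := flipmul h.s0 h.s1 (JJ_transpose _) h.m01
lemma Quad.m20 (h : Quad ι h0 h1 h2 h3) : h2 * h0 = JJ ι := flipmul h.s0 h.s2 (JJ_transpose _) h.m02
lemma Quad.m21 (h : Quad ι h0 h1 h2 h3) : h2 * h1 = JJ ι := flipmul h.s1 h.s2 (JJ_transpose _) h.m12
lemma Quad.m30 (h : Quad ι h0 h1 h2 h3) : h3 * h0 = - JJ ι := flipmul h.s0 h.s3 negJ_tr h.m03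
lemma Quad.m31 (h : Quad ι h0 h1 h2 h3) : h3 * h1 = - JJ ι := flipmul h.s1 h.s3 negJ_tr h.m13
lemma Quad.m32 (h : Quad ι h0 h1 h2 h3) : h3 * h2 = - JJ ι := flipmul h.s2 h.s3 negJ_tr h.m23
end

def TypeH (v : ℕ) : Prop :=
  ∃ (ι : Type) (_ : Fintype ι) (_ : DecidableEq ι) (h0 h1 h2 h3 : Matrix ι ι ℚ),
    Fintype.card ι = v ∧ Quad ι h0 h1 h2 h3

lemma typeH_one : TypeH 1 := by
  refine ⟨Unit, inferInstance, inferInstance, 1, 1, 1, -1, by simp, ?_⟩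
  have hJ : JJ Unit = 1 := by ext i j; simp [JJ]
  constructor <;> simp [IsPM, hJ]
  ext i j; simp [Matrix.one_apply]; norm_num

lemma neg_kron {a b c d : Type*} (A : Matrix a b ℚ) (B : Matrix c d ℚ) :
    (-A) ⊗ₖ B = -(A ⊗ₖ B) := by ext i j; simp [Matrix.kroneckerMap_apply]
lemma kron_neg {a b c d : Type*} (A : Matrix a b ℚ) (B : Matrix c d ℚ) :
    A ⊗ₖ (-B) = -(A ⊗ₖ B) := by ext i j; simp [Matrix.kroneckerMap_apply]

lemma mixPM {a b c d : Type*} {A B : Matrix a b ℚ} {C D : Matrix c d ℚ}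
    (hA : IsPM A) (hB : IsPM B) (hC : IsPM C) (hD : IsPM D) :
    IsPM (((1/2 : ℚ) • (A + B)) ⊗ₖ C + ((1/2 : ℚ) • (A - B)) ⊗ₖ D) := by
  intro i j
  simp only [Matrix.add_apply, Matrix.kroneckerMap_apply, Matrix.smul_apply, Matrix.sub_apply]
  rcases hA i.1 j.1 with h | h <;> rcases hB i.1 j.1 with h' | h' <;>
  rcases hC i.2 j.2 with g | g <;> rcases hD i.2 j.2 with g' | g' <;> 
    simp only [h, h', g, g'] <;> norm_num

lemma TypeH.mul {v w : ℕ} (hv : TypeH v) (hw : TypeH w) : TypeH (v * w) := by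
  obtain ⟨ι, _, _, h0, h1, h2, h3, rfl, h⟩ := hv
  obtain ⟨κ, _, _, k0, k1, k2, k3, rfl, k⟩ := hw
  let P := (1/2 : ℚ) • (h0 + h1)
  let M := (1/2 : ℚ) • (h0 - h1)
  let Q := (1/2 : ℚ) • (h2 + h3)
  let N := (1/2 : ℚ) • (h2 - h3)
  have sP : Pᵀ = P := by simp [P, h.s0, h.s1]
  have sM : Mᵀ = M := by simp [M, h.s0, h.s1]
  have sQ : Qᵀ = Q := by simp [Q, h.s2, h.s3]
  have sN : Nᵀ = N := by simp [N, h.s2, h.s3]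
  have PQ : P * Q = 0 := by
    simp only [P, Q, Matrix.smul_mul, Matrix.mul_smul, add_mul, mul_add, h.m02, h.m03, h.m12, h.m13]; module
  have MN : M * N = 0 := by
    simp only [M, N, Matrix.smul_mul, Matrix.mul_smul, sub_mul, mul_sub, h.m02, h.m03, h.m12, h.m13]; module
  have PN : P * N = JJ ι := by
    simp only [P, N, Matrix.smul_mul, Matrix.mul_smul, add_mul, mul_sub, h.m02, h.m03, h.m12, h.m13]; module
  have MQ : M * Q = 0 := by
    simp only [M, Q, Matrix.smul_mul, Matrix.mul_smul, sub_mul, mul_add, h.m02, h.m03, h.m12, h.m13]; module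
  have PP : P * P = M * M + JJ ι := by
    simp only [M, P, Matrix.smul_mul, Matrix.mul_smul, add_mul, mul_add, mul_sub, sub_mul, h.m01, h.m10]; module
  have NN : N * N = Q * Q + JJ ι := by
    simp only [N, Q, Matrix.smul_mul, Matrix.mul_smul, add_mul, mul_add, mul_sub, sub_mul, h.m23, h.m32]; module
  have PM : P * M = M * P := by
    simp only [M, P, Matrix.smul_mul, Matrix.mul_smul, add_mul, mul_add, mul_sub, sub_mul, h.m01, h.m10]; module
  have QN : Q * N = N * Q := by
    simp only [N, Q, Matrix.smul_mul, Matrix.mul_smul, add_mul, mul_add, mul_sub, sub_mul, h.m23, h.m32]; module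
  have MMQQ : M * M + Q * Q + JJ ι = (Fintype.card ι : ℚ) • 1 := by
    have h4 : (4 : ℚ) • (M * M + Q * Q + JJ ι) = (4 : ℚ) • ((Fintype.card ι : ℚ) • 1) := by
      rw [smul_smul, ← h.sum]
      simp only [M, Q, Matrix.smul_mul, Matrix.mul_smul, add_mul, mul_add, mul_sub, sub_mul, h.m23, h.m32,
        h.m01, h.m10]; module
    exact smul_right_injective _ (by norm_num : (4 : ℚ) ≠ 0) h4
  have K : k0 * k0 + k1 * k1 + k2 * k2 + k3 * k3 = (4 * (Fintype.card κ : ℚ)) • 1 := k.sum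
  have p0 : IsPM (P ⊗ₖ k0 + M ⊗ₖ k1) := mixPM h.pm0 h.pm1 k.pm0 k.pm1
  have p1 : IsPM (P ⊗ₖ k2 + M ⊗ₖ k3) := mixPM h.pm0 h.pm1 k.pm2 k.pm3
  have p2 : IsPM (Q ⊗ₖ k0 + N ⊗ₖ k1) := mixPM h.pm2 h.pm3 k.pm0 k.pm1
  have p3 : IsPM (Q ⊗ₖ k2 + N ⊗ₖ k3) := mixPM h.pm2 h.pm3 k.pm2 k.pm3
  clear_value P M Q N
  have tr : ∀ (A : Matrix ι ι ℚ) (B : Matrix κ κ ℚ), (A ⊗ₖ B)ᵀ = Aᵀ ⊗ₖ Bᵀ :=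
    fun A B => (kroneckerMap_transpose _ _ _).symm
  refine ⟨ι × κ, inferInstance, inferInstance, P ⊗ₖ k0 + M ⊗ₖ k1, P ⊗ₖ k2 + M ⊗ₖ k3,
    Q ⊗ₖ k0 + N ⊗ₖ k1, Q ⊗ₖ k2 + N ⊗ₖ k3, by simp, p0, p1, p2, p3, ?_, ?_, ?_, ?_,
    ?_, ?_, ?_, ?_, ?_, ?_, ?_⟩
  · simp [tr, sP, sM, k.s0, k.s1]
  · simp [tr, sP, sM, k.s2, k.s3]
  · simp [tr, sQ, sN, k.s0, k.s1]
  · simp [tr, sQ, sN, k.s2, k.s3]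
  · simp only [add_mul, mul_add, ← Matrix.mul_kronecker_mul, k.m02, k.m03, k.m12, k.m13, PP, PM,
      Matrix.add_kronecker, kron_neg, JJ_kron]; abel
  · simp only [add_mul, mul_add, ← Matrix.mul_kronecker_mul, PQ, PN, MQ, MN, k.m01, JJ_kron,
      Matrix.zero_kronecker]; abel
  · simp only [add_mul, mul_add, ← Matrix.mul_kronecker_mul, PQ, PN, MQ, MN, k.m21, JJ_kron,
      Matrix.zero_kronecker]; abel
  · simp only [add_mul, mul_add, ← Matrix.mul_kronecker_mul, PQ, PN, MQ, MN, k.m03, JJ_kron,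
      Matrix.zero_kronecker, kron_neg]; abel
  · simp only [add_mul, mul_add, ← Matrix.mul_kronecker_mul, PQ, PN, MQ, MN, k.m23, JJ_kron,
      Matrix.zero_kronecker, kron_neg]; abel
  · simp only [add_mul, mul_add, ← Matrix.mul_kronecker_mul, k.m02, k.m03, k.m12, k.m13, NN, QN,
      Matrix.add_kronecker, kron_neg, JJ_kron]; abel
  · have e1 : (M * M + Q * Q + JJ ι) ⊗ₖ (k0 * k0 + k1 * k1 + k2 * k2 + k3 * k3) =
      (4 * (Fintype.card (ι × κ) : ℚ)) • 1 := by
      rw [MMQQ, K, Matrix.smul_kronecker, Matrix.kronecker_smul, Matrix.one_kronecker_one, smul_smul]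
      congr 1
      rw [Fintype.card_prod]; push_cast; ring
    rw [← e1]
    simp only [add_mul, mul_add, ← Matrix.mul_kronecker_mul, k.m01, k.m10, k.m23, k.m32, NN, PP, QN, PM,
      Matrix.add_kronecker, Matrix.kronecker_add, kron_neg, JJ_kron]
    abel
end PH

set_option linter.unusedSectionVars false
namespace PH
open Matrix

section prime
variable {K : Type} [Field K] [Fintype K] [DecidableEq K]

def pt : Option K → K × K
  | some c => (1, c)
  | none => (0, 1)
def Bf (u v : K × K) : K := u.1 * v.2 - u.2 * v.1
def cf : Option K → K × K → K
  | some _, x => x.1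
  | none, x => x.2
def gl (f : K → ℚ) (u : Option K) (x : K × K) : ℚ := if Bf (pt u) x = 0 then f (cf u x) else 0

lemma on_line (u : Option K) (x : K × K) (ν : K) :
    x = ν • pt u ↔ Bf (pt u) x = 0 ∧ ν = cf u x := by
  obtain ⟨x1, x2⟩ := x
  cases u with
  | none =>
    simp only [pt, Bf, cf, Prod.smul_mk, smul_eq_mul, Prod.mk.injEq]
    constructor
    · rintro ⟨rfl, rfl⟩; simp
    · rintro ⟨h, rfl⟩; simpa using h
  | some c =>
    simp only [pt, Bf, cf, Prod.smul_mk, smul_eq_mul, Prod.mk.injEq]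
    constructor
    · rintro ⟨rfl, rfl⟩; constructor <;> ring
    · rintro ⟨h, rfl⟩; constructor; · ring
      linear_combination h

lemma gl_sum (f : K → ℚ) (u : Option K) (x : K × K) :
    gl f u x = ∑ ν, if x = ν • pt u then f ν else 0 := by
  simp only [on_line, gl]
  by_cases h : Bf (pt u) x = 0 <;> simp [h]

lemma conv1 (G : K × K → ℚ) (f : K → ℚ) (u : Option K) :
    ∑ x, G x * gl f u x = ∑ ν, G (ν • pt u) * f ν := by
  simp only [gl_sum, Finset.mul_sum]
  rw [Finset.sum_comm]
  refine Finset.sum_congr rfl fun ν _ => ?_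
  simp

lemma Bf_sub (u v w : K × K) (ν : K) : Bf u (v - ν • w) = Bf u v - ν * Bf u w := by
  simp [Bf]; ring

lemma Bf_self (u : K × K) : Bf u u = 0 := by simp [Bf]; ring

lemma Bf_ne {u w : Option K} (h : u ≠ w) : Bf (pt u) (pt w) ≠ 0 := by
  cases u <;> cases w <;> simp [pt, Bf] at h ⊢
  intro h'; exact h (sub_eq_zero.1 h').symm

lemma conv_ne (f g : K → ℚ) {u w : Option K} (h : u ≠ w) (v : K × K) :
    ∑ x, gl f u (v - x) * gl g w x =
      f (Bf v (pt w) / Bf (pt u) (pt w)) * g (Bf (pt u) v / Bf (pt u) (pt w)) := by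
  rw [conv1 (fun x => gl f u (v - x))]
  have hB := Bf_ne h
  have key : ∀ ν, gl f u (v - ν • pt w) * g ν =
      if ν = Bf (pt u) v / Bf (pt u) (pt w) then
        f (Bf v (pt w) / Bf (pt u) (pt w)) * g (Bf (pt u) v / Bf (pt u) (pt w)) else 0 := by
    intro ν
    simp only [gl, Bf_sub]
    have e : (Bf (pt u) v - ν * Bf (pt u) (pt w) = 0) ↔ ν = Bf (pt u) v / Bf (pt u) (pt w) := by
      rw [eq_div_iff hB, sub_eq_zero, eq_comm]
    simp only [e]
    split_ifs with h1
    · rw [← h1]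
      congr 2
      have h2 := (e.2 h1)
      rw [eq_div_iff hB]
      obtain ⟨v1, v2⟩ := v
      rcases u with _ | c <;> rcases w with _ | d <;>
        simp only [pt, Bf, cf, Prod.fst_sub, Prod.snd_sub, Prod.smul_mk, smul_eq_mul, ne_eq, not_true_eq_false] at h2 h ⊢ <;>
        first | linear_combination h2 | linear_combination d * h2 | ring
    · simp
  simp [key]

lemma conv_eq (f g : K → ℚ) (u : Option K) (v : K × K) :
    ∑ x, gl f u (v - x) * gl g u x = if Bf (pt u) v = 0 then ∑ ν, f (cf u v - ν) * g ν else 0 := by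
  rw [conv1 (fun x => gl f u (v - x))]
  simp only [gl, Bf_sub, Bf_self, mul_zero, sub_zero]
  split_ifs
  · refine Finset.sum_congr rfl fun ν _ => ?_
    congr 2
    cases u <;> simp [cf, pt]
  · simp

def eta (x : K) : ℚ := (quadraticChar K x : ℚ)

lemma eta_mul (x y : K) : eta (x * y) = eta x * eta y := by
  unfold eta; rw [map_mul]; push_cast; rfl
lemma eta_zero : eta (0 : K) = 0 := by simp [eta]
lemma eta_sq {x : K} (h : x ≠ 0) : eta x * eta x = 1 := by
  have := quadraticChar_sq_one h
  rw [sq] at this; unfold eta; exact_mod_cast this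
lemma eta_div (x : K) {y : K} (h : y ≠ 0) : eta (x / y) = eta x * eta y := by
  have : eta x = eta (x / y) * eta y := by rw [← eta_mul]; congr 1; field_simp
  rw [this, mul_assoc, eta_sq h, mul_one]
lemma eta_pm {x : K} (h : x ≠ 0) : eta x = 1 ∨ eta x = -1 := by
  rcases quadraticChar_dichotomy h with h | h <;> simp [eta, h]
lemma eta_sum (hK : ringChar K ≠ 2) : ∑ x : K, eta x = 0 := by
  have := quadraticChar_sum_zero hK
  unfold eta; exact_mod_cast this

lemma conv_eta (hn : eta (-1 : K) = 1) (hK : ringChar K ≠ 2) (l : K) :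
    ∑ ν : K, eta (l - ν) * eta ν = (Fintype.card K : ℚ) * (if l = 0 then 1 else 0) - 1 := by
  by_cases hl : l = 0
  · subst hl
    have e : ∀ ν : K, eta (0 - ν) * eta ν = 1 - if ν = 0 then 1 else 0 := by
      intro ν
      rw [show (0 - ν) = (-1) * ν by ring, eta_mul, hn, one_mul]
      split_ifs with h
      · simp [h, eta_zero]
      · simp [eta_sq h]
    rw [Finset.sum_congr rfl fun ν _ => e ν]
    simp
  · simp only [hl, if_false, mul_zero, zero_sub]
    -- for ν ≠ 0: eta (l-ν) eta ν = eta (l/ν - 1)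
    have e : ∀ ν : K, ν ≠ 0 → eta (l - ν) * eta ν = eta (l / ν - 1) := by
      intro ν h
      rw [← eta_div _ h]; congr 1; field_simp
    have h1 : ∑ ν : K, eta (l - ν) * eta ν = ∑ ν ∈ Finset.univ.erase (0 : K), eta (l / ν - 1) := by
      rw [← Finset.add_sum_erase _ _ (Finset.mem_univ (0 : K))]
      rw [eta_zero, mul_zero, zero_add]
      exact Finset.sum_congr rfl fun ν h => e ν (Finset.ne_of_mem_erase h)
    have h2 : ∑ ν ∈ Finset.univ.erase (0 : K), eta (l / ν - 1) =
        ∑ x ∈ Finset.univ.erase (-1 : K), eta x := by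
      refine Finset.sum_bij' (fun ν _ => l / ν - 1) (fun x _ => l / (x + 1)) ?_ ?_ ?_ ?_ ?_
      · intro a ha
        have := Finset.ne_of_mem_erase ha
        simp only [Finset.mem_erase, Finset.mem_univ, and_true]
        intro h
        have : l / a = 0 := by linear_combination h
        simp_all
      · intro a ha
        have := Finset.ne_of_mem_erase ha
        simp only [Finset.mem_erase, Finset.mem_univ, and_true]
        have : a + 1 ≠ 0 := fun h => this (by linear_combination h)
        exact div_ne_zero hl this
      · intro a ha
        have := Finset.ne_of_mem_erase ha
        rw [sub_add_cancel, div_div_cancel₀ hl]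
      · intro a ha
        have := Finset.ne_of_mem_erase ha
        have : a + 1 ≠ 0 := fun h => this (by linear_combination h)
        field_simp; ring
      · intros; rfl
    rw [h1, h2]
    have h3 := Finset.add_sum_erase Finset.univ (fun x : K => eta x) (Finset.mem_univ (-1))
    simp only [eta_sum hK, hn] at h3
    linarith

end prime
end PH

set_option linter.unusedSectionVars false
namespace PH
open Matrix

section prime
variable {K : Type} [Field K] [Fintype K] [DecidableEq K]

lemma exists_pt (v : K × K) : ∃ (l : K) (u : Option K), v = l • pt u := by
  obtain ⟨x, y⟩ := v
  by_cases h : x = 0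
  · exact ⟨y, none, by simp [pt, h]⟩
  · exact ⟨x, some (y / x), by simp [pt]; field_simp⟩

lemma gl_pt (f : K → ℚ) (w u : Option K) {l : K} (hl : l ≠ 0) :
    gl f w (l • pt u) = if w = u then f l else 0 := by
  unfold gl
  have hs : Bf (pt w) (l • pt u) = l * Bf (pt w) (pt u) := by simp [Bf]; ring
  rw [hs]
  by_cases h : w = u
  · subst h
    simp only [Bf_self, mul_zero, if_true]
    congr 1
    cases w <;> simp [cf, pt]
  · simp [h, hl, Bf_ne h]

lemma gl_zero (f : K → ℚ) (w : Option K) : gl f w 0 = f 0 := by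
  unfold gl
  cases w <;> simp [Bf, cf]

def cb (a : Option K → ℚ) (f : K → ℚ) (v : K × K) : ℚ := ∑ u, a u * gl f u v

lemma cb_pt (a : Option K → ℚ) (f : K → ℚ) (u : Option K) {l : K} (hl : l ≠ 0) :
    cb a f (l • pt u) = a u * f l := by
  simp [cb, gl_pt _ _ _ hl]

lemma cb_zero (a : Option K → ℚ) (f : K → ℚ) : cb a f 0 = (∑ u, a u) * f 0 := by
  simp only [cb, gl_zero, Finset.sum_mul]

lemma conv_cb (a b : Option K → ℚ) (f g : K → ℚ) :
    circulant (cb a f) * circulant (cb b g) =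
      circulant fun v => ∑ u, ∑ w, a u * b w * ∑ x, gl f u (v - x) * gl g w x := by
  rw [circulant_mul]
  congr 1
  ext v
  simp only [mulVec, dotProduct, circulant_apply, cb, Finset.sum_mul_sum]
  rw [Finset.sum_comm]
  refine Finset.sum_congr rfl fun u _ => ?_
  rw [Finset.sum_comm]
  refine Finset.sum_congr rfl fun w _ => ?_
  rw [Finset.mul_sum]
  refine Finset.sum_congr rfl fun x _ => ?_
  ring

lemma Bf_swap (u v : K × K) : Bf u v = (-1) * Bf v u := by simp [Bf]; ring

lemma eta_Bf_swap (hn : eta (-1 : K) = 1) (u v : K × K) : eta (Bf u v) = eta (Bf v u) := by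
  rw [Bf_swap, eta_mul, hn, one_mul]

lemma ph_ph (hn : eta (-1 : K) = 1) (hK : ringChar K ≠ 2) (u w : Option K) (v : K × K) :
    ∑ x, gl eta u (v - x) * gl eta w x = eta (Bf (pt w) v) * eta (Bf (pt u) v)
      + if u = w then (Fintype.card K : ℚ) * (if v = 0 then 1 else 0) - 1 else 0 := by
  by_cases h : u = w
  · subst h
    rw [conv_eq, conv_eta hn hK]
    simp only [if_true]
    by_cases hB : Bf (pt u) v = 0
    · rw [if_pos hB, hB, eta_zero]
      have : cf u v = 0 ↔ v = 0 := by
        have := on_line u v (cf u v)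
        simp only [hB, and_self, iff_true] at this
        constructor
        · intro h; rw [this, h, zero_smul]
        · intro h; rw [h]; cases u <;> simp [cf]
      simp [this]
    · have hv : v ≠ 0 := by rintro rfl; exact hB (by simp [Bf])
      rw [if_neg hB, eta_sq hB]; simp [hv]
  · rw [conv_ne _ _ h, eta_div _ (Bf_ne h), eta_div _ (Bf_ne h), eta_Bf_swap hn v]
    simp only [h, if_false, add_zero]
    linear_combination (eta (Bf (pt w) v) * eta (Bf (pt u) v)) * eta_sq (Bf_ne h)

lemma ln_ln (hn : eta (-1 : K) = 1) (hK : ringChar K ≠ 2) (u w : Option K) (v : K × K) :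
    ∑ x, gl (fun _ => 1) u (v - x) * gl (fun _ => 1) w x = 1
      + if u = w then (Fintype.card K : ℚ) * gl (fun _ => 1) u v - 1 else 0 := by
  by_cases h : u = w
  · subst h
    rw [conv_eq]
    simp [gl]
  · rw [conv_ne _ _ h]; simp [h]

lemma ln_ph (hn : eta (-1 : K) = 1) (hK : ringChar K ≠ 2) (u w : Option K) (v : K × K) :
    ∑ x, gl (fun _ => 1) u (v - x) * gl eta w x = eta (Bf (pt u) v) * eta (Bf (pt u) (pt w)) := by
  by_cases h : u = w
  · subst h
    rw [conv_eq]
    simp [eta_sum hK, Bf_self, eta_zero]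
  · rw [conv_ne _ _ h, eta_div _ (Bf_ne h)]; simp

lemma eig_ext (hn : eta (-1 : K) = 1) (hK : ringChar K ≠ 2) {z : Option K → ℚ} {s : ℚ}
    (hz : ∀ u, ∑ w, z w * eta (Bf (pt w) (pt u)) = s * z u) (v : K × K) :
    ∑ w, z w * eta (Bf (pt w) v) = s * cb z eta v := by
  obtain ⟨l, u, rfl⟩ := exists_pt v
  by_cases hl : l = 0
  · subst hl; simp [cb_zero, eta_zero, Bf]
  · have hs : ∀ w : Option K, Bf (pt w) (l • pt u) = l * Bf (pt w) (pt u) := by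
      intro w; simp [Bf]; ring
    simp only [hs, cb_pt _ _ _ hl, eta_mul]
    have := hz u
    calc _ = eta l * ∑ w, z w * eta (Bf (pt w) (pt u)) := by
          rw [Finset.mul_sum]; exact Finset.sum_congr rfl fun _ _ => by ring
      _ = _ := by rw [this]; ring

lemma ZY_mul (hn : eta (-1 : K) = 1) (hK : ringChar K ≠ 2) {z y : Option K → ℚ} {s t : ℚ}
    (hz : ∀ u, ∑ w, z w * eta (Bf (pt w) (pt u)) = s * z u)
    (hy : ∀ u, ∑ w, y w * eta (Bf (pt w) (pt u)) = t * y u) :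
    circulant (cb z eta) * circulant (cb y eta) = circulant fun v =>
      s * t * cb z eta v * cb y eta v +
      (∑ u, z u * y u) * ((Fintype.card K : ℚ) * (if v = 0 then 1 else 0) - 1) := by
  rw [conv_cb]
  congr 1
  ext v
  simp only [ph_ph hn hK, mul_add, Finset.sum_add_distrib]
  congr 1
  · calc _ = (∑ w, z w * eta (Bf (pt w) v)) * (∑ w, y w * eta (Bf (pt w) v)) := by
          rw [Finset.sum_mul_sum]
          exact Finset.sum_congr rfl fun _ _ => Finset.sum_congr rfl fun _ _ => by ring
      _ = _ := by rw [eig_ext hn hK hz, eig_ext hn hK hy]; ring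
  · simp only [mul_ite, mul_zero, Finset.sum_ite_eq, Finset.mem_univ, if_true, Finset.sum_mul]

lemma AB_mul (hn : eta (-1 : K) = 1) (hK : ringChar K ≠ 2) (a b : Option K → ℚ) :
    circulant (cb a fun _ => 1) * circulant (cb b fun _ => 1) = circulant fun v : K × K =>
      (∑ u, a u) * (∑ u, b u) + ((Fintype.card K : ℚ) * cb (fun u => a u * b u) (fun _ => 1) v
        - ∑ u, a u * b u) := by
  rw [conv_cb]
  congr 1
  ext v
  simp only [ln_ln hn hK, mul_add, Finset.sum_add_distrib]
  congr 1
  · simp only [Finset.sum_mul_sum, mul_one]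
  · simp only [mul_ite, mul_zero, Finset.sum_ite_eq, Finset.mem_univ, if_true, cb, Finset.mul_sum]
    rw [← Finset.sum_sub_distrib]
    exact Finset.sum_congr rfl fun _ _ => by ring

lemma AF_mul (hn : eta (-1 : K) = 1) (hK : ringChar K ≠ 2) {a z : Option K → ℚ}
    (h : ∀ u, a u * ∑ w, z w * eta (Bf (pt w) (pt u)) = 0) :
    circulant (cb a fun _ => 1) * circulant (cb z eta) = 0 := by
  rw [conv_cb]
  ext i j
  simp only [circulant_apply, ln_ph hn hK, Matrix.zero_apply]
  refine Finset.sum_eq_zero fun u _ => ?_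
  calc _ = (a u * ∑ w, z w * eta (Bf (pt w) (pt u))) * eta (Bf (pt u) (i - j)) := by
        rw [Finset.mul_sum, Finset.sum_mul]
        refine Finset.sum_congr rfl fun w _ => ?_
        rw [eta_Bf_swap hn (pt u) (pt w)]; ring
    _ = 0 := by rw [h, zero_mul]

end prime
end PH

set_option linter.unusedSectionVars false
namespace PH
open Matrix

lemma exists_sign {ι : Type} [DecidableEq ι] (S : Finset ι) (h : S.card % 2 = 1) :
    ∃ e : ι → ℚ, (∀ u ∈ S, e u = 1 ∨ e u = -1) ∧ (∀ u ∉ S, e u = 0) ∧ ∑ u ∈ S, e u = 1 := by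
  obtain ⟨T, hT, hc⟩ := Finset.exists_subset_card_eq (show (S.card + 1) / 2 ≤ S.card by omega)
  refine ⟨fun u => if u ∈ T then 1 else if u ∈ S then -1 else 0, ?_, ?_, ?_⟩
  · intro u hu; by_cases h : u ∈ T <;> simp [h, hu]
  · intro u hu; have : u ∉ T := fun h => hu (hT h)
    simp [this, hu]
  · rw [← Finset.sum_sdiff hT]
    have h1 : ∑ u ∈ T, (if u ∈ T then (1 : ℚ) else if u ∈ S then -1 else 0) = T.card := by
      rw [Finset.sum_congr rfl fun u hu => if_pos hu]; simp
    have h2 : ∑ u ∈ S \ T, (if u ∈ T then (1 : ℚ) else if u ∈ S then -1 else 0) = -((S \ T).card) := by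
      rw [Finset.sum_congr rfl fun u hu => ?_, Finset.sum_const]
      rotate_left
      · exact (-1 : ℚ)
      · rw [Finset.mem_sdiff] at hu; simp [hu.1, hu.2]
      · simp
    rw [h1, h2, Finset.card_sdiff_of_subset hT, hc]
    have : S.card = 2 * ((S.card + 1) / 2) - 1 := by omega
    have e : S.card - (S.card + 1) / 2 + 1 = (S.card + 1) / 2 := by omega
    have e' : ((S.card - (S.card + 1) / 2 : ℕ) : ℚ) + 1 = ((S.card + 1) / 2 : ℕ) := by exact_mod_cast e
    linarith

section prime
variable {K : Type} [Field K] [Fintype K] [DecidableEq K]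

lemma prime_core (hn : eta (-1 : K) = 1) (hK : ringChar K ≠ 2) (hcard : Fintype.card K % 4 = 1)
    {q : ℚ} (hq : q * q = Fintype.card K) {z y : Option K → ℚ}
    (pz : ∀ u, z u = 1 ∨ z u = -1) (py : ∀ u, y u = 1 ∨ y u = -1)
    (hz : ∀ u, ∑ w, z w * eta (Bf (pt w) (pt u)) = q * z u)
    (hy : ∀ u, ∑ w, y w * eta (Bf (pt w) (pt u)) = (-q) * y u) :
    TypeH (Fintype.card K * Fintype.card K) := by
  have hq0 : q ≠ 0 := by
    rintro rfl
    have : (Fintype.card K : ℚ) ≠ 0 := by exact_mod_cast Fintype.card_ne_zero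
    exact this (by rw [← hq]; ring)
  have zz : ∀ u, z u * z u = 1 := fun u => by rcases pz u with h | h <;> rw [h] <;> norm_num
  have yy : ∀ u, y u * y u = 1 := fun u => by rcases py u with h | h <;> rw [h] <;> norm_num
  have hcO : ((Finset.univ : Finset (Option K)).card : ℚ) = Fintype.card K + 1 := by
    rw [Finset.card_univ, Fintype.card_option]; push_cast; rfl
  have szz : ∑ u, z u * z u = Fintype.card K + 1 := by
    simp only [zz, Finset.sum_const, nsmul_eq_mul, mul_one, hcO]
  have syy : ∑ u, y u * y u = Fintype.card K + 1 := by
    simp only [yy, Finset.sum_const, nsmul_eq_mul, mul_one, hcO]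
  -- orthogonality
  have szy : ∑ u, z u * y u = 0 := by
    have e1 : ∑ u, y u * (∑ w, z w * eta (Bf (pt w) (pt u))) =
        ∑ w, z w * (∑ u, y u * eta (Bf (pt u) (pt w))) := by
      simp only [Finset.mul_sum]
      rw [Finset.sum_comm]
      refine Finset.sum_congr rfl fun w _ => Finset.sum_congr rfl fun u _ => ?_
      rw [eta_Bf_swap hn (pt w) (pt u)]; ring
    simp only [hz, hy] at e1
    have e2 : ∑ u, y u * (q * z u) = q * ∑ u, z u * y u := by
      rw [Finset.mul_sum]; exact Finset.sum_congr rfl fun _ _ => by ring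
    have e3 : ∑ u, z u * ((-q) * y u) = -(q * ∑ u, z u * y u) := by
      rw [Finset.mul_sum, ← Finset.sum_neg_distrib]; exact Finset.sum_congr rfl fun _ _ => by ring
    rw [e2, e3] at e1
    have : q * ∑ u, z u * y u = 0 := by linarith
    exact (mul_eq_zero.1 this).resolve_left hq0
  -- the sets
  let S1 : Finset (Option K) := Finset.univ.filter fun u => z u = y u
  let S2 : Finset (Option K) := Finset.univ.filter fun u => ¬ z u = y u
  have c12 : S1.card + S2.card = Fintype.card K + 1 := by
    rw [Finset.card_filter_add_card_filter_not, Finset.card_univ, Fintype.card_option]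
  have cd : S1.card = S2.card := by
    have e : ∀ u, z u * y u = (if z u = y u then 1 else 0) - (if ¬ z u = y u then 1 else 0) := by
      intro u
      rcases pz u with h | h <;> rcases py u with h' | h' <;> rw [h, h'] <;> norm_num
    have := szy
    rw [Finset.sum_congr rfl fun u _ => e u, Finset.sum_sub_distrib, Finset.sum_boole,
      Finset.sum_boole, sub_eq_zero] at this
    exact_mod_cast this
  obtain ⟨b, hb1, hb2, hb3⟩ := exists_sign S1 (by omega)
  obtain ⟨a, ha1, ha2, ha3⟩ := exists_sign S2 (by omega)
  have sa : ∑ u, a u = 1 := by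
    rw [← ha3]; exact (Finset.sum_subset (Finset.subset_univ _) fun u _ h => ha2 u h).symm
  have sb : ∑ u, b u = 1 := by
    rw [← hb3]; exact (Finset.sum_subset (Finset.subset_univ _) fun u _ h => hb2 u h).symm
  have cases : ∀ u, (z u = y u ∧ a u = 0 ∧ (b u = 1 ∨ b u = -1)) ∨
      (z u = - y u ∧ b u = 0 ∧ (a u = 1 ∨ a u = -1)) := by
    intro u
    by_cases h : z u = y u
    · left
      exact ⟨h, ha2 u (by simp [S2, h]), hb1 u (by simp [S1, h])⟩
    · right
      refine ⟨?_, hb2 u (by simp [S1, h]), ha1 u (by simp [S2, h])⟩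
      rcases pz u with h1 | h1 <;> rcases py u with h2 | h2 <;> first | exact absurd (h1.trans h2.symm) h | simp [h1, h2]
  have aa : ∀ u, a u * a u = (1 - z u * y u) / 2 := by
    intro u
    rcases cases u with ⟨h1, h2, h3⟩ | ⟨h1, h2, h3⟩
    · rw [h1, h2, yy]; norm_num
    · rw [h1, neg_mul, yy]; rcases h3 with h | h <;> rw [h] <;> norm_num
  have bb : ∀ u, b u * b u = (1 + z u * y u) / 2 := by
    intro u
    rcases cases u with ⟨h1, h2, h3⟩ | ⟨h1, h2, h3⟩
    · rw [h1, yy]; rcases h3 with h | h <;> rw [h] <;> norm_num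
    · rw [h1, h2, neg_mul, yy]; norm_num
  have ab : ∀ u, a u * b u = 0 := by
    intro u
    rcases cases u with ⟨h1, h2, h3⟩ | ⟨h1, h2, h3⟩ <;> rw [h2] <;> ring
  have az : ∀ u, a u * (z u + y u) = 0 := by
    intro u
    rcases cases u with ⟨h1, h2, h3⟩ | ⟨h1, h2, h3⟩
    · rw [h2]; ring
    · rw [h1]; ring
  have bz : ∀ u, b u * (z u - y u) = 0 := by
    intro u
    rcases cases u with ⟨h1, h2, h3⟩ | ⟨h1, h2, h3⟩
    · rw [h1]; ring
    · rw [h2]; ring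
  have saa : ∑ u, a u * a u = (Fintype.card K + 1) / 2 := by
    simp only [aa]; rw [← Finset.sum_div, Finset.sum_sub_distrib, szy]
    simp only [Finset.sum_const, nsmul_eq_mul, hcO]; ring
  have sbb : ∑ u, b u * b u = (Fintype.card K + 1) / 2 := by
    simp only [bb]; rw [← Finset.sum_div, Finset.sum_add_distrib, szy]
    simp only [Finset.sum_const, nsmul_eq_mul, hcO]; ring
  let f1 : Option K → ℚ := fun u => (z u + y u) / 2
  let f2 : Option K → ℚ := fun u => (z u - y u) / 2
  let A := circulant (cb a fun _ => 1)
  let B := circulant (cb b fun _ => 1)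
  let Z := circulant (cb z eta)
  let Y := circulant (cb y eta)
  let F1 := circulant (cb f1 eta)
  let F2 := circulant (cb f2 eta)
  have hF1 : F1 = (1/2 : ℚ) • (Z + Y) := by
    ext i j
    simp only [F1, Z, Y, circulant_apply, Matrix.smul_apply, Matrix.add_apply, cb, smul_eq_mul, f1]
    rw [← Finset.sum_add_distrib, Finset.mul_sum]
    exact Finset.sum_congr rfl fun _ _ => by ring
  have hF2 : F2 = (1/2 : ℚ) • (Z - Y) := by
    ext i j
    simp only [F2, Z, Y, circulant_apply, Matrix.smul_apply, Matrix.sub_apply, cb, smul_eq_mul, f2]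
    rw [← Finset.sum_sub_distrib, Finset.mul_sum]
    exact Finset.sum_congr rfl fun _ _ => by ring
  have AF2 : A * F2 = 0 := by
    refine AF_mul hn hK fun u => ?_
    have : ∑ w, f2 w * eta (Bf (pt w) (pt u)) = q * (z u + y u) / 2 := by
      calc _ = ((∑ w, z w * eta (Bf (pt w) (pt u))) - ∑ w, y w * eta (Bf (pt w) (pt u))) / 2 := by
            rw [← Finset.sum_sub_distrib, Finset.sum_div]
            exact Finset.sum_congr rfl fun _ _ => by simp only [f2]; ring
        _ = _ := by rw [hz, hy]; ring
    rw [this]; linear_combination (q / 2) * az u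
  have BF1 : B * F1 = 0 := by
    refine AF_mul hn hK fun u => ?_
    have : ∑ w, f1 w * eta (Bf (pt w) (pt u)) = q * (z u - y u) / 2 := by
      calc _ = ((∑ w, z w * eta (Bf (pt w) (pt u))) + ∑ w, y w * eta (Bf (pt w) (pt u))) / 2 := by
            rw [← Finset.sum_add_distrib, Finset.sum_div]
            exact Finset.sum_congr rfl fun _ _ => by simp only [f1]; ring
        _ = _ := by rw [hz, hy]; ring
    rw [this]; linear_combination (q / 2) * bz u
  have F2A : F2 * A = 0 := by rw [← AF2]; exact circulant_mul_comm _ _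
  have F1B : F1 * B = 0 := by rw [← BF1]; exact circulant_mul_comm _ _
  have F1A : F1 * A = A * F1 := circulant_mul_comm _ _
  have F2B : F2 * B = B * F2 := circulant_mul_comm _ _
  have BA : B * A = A * B := circulant_mul_comm _ _
  have YZ : Y * Z = Z * Y := circulant_mul_comm _ _
  have AB : A * B = JJ _ := by
    simp only [A, B]
    rw [AB_mul hn hK, sa, sb]
    ext i j
    simp [JJ, circulant_apply, cb, ab]
  set V := (Fintype.card (K × K) : ℚ) with hV
  have hV2 : V = (Fintype.card K : ℚ) * Fintype.card K := by
    rw [hV, Fintype.card_prod]; push_cast; rfl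
  -- squares
  have ZZ : Z * Z = V • 1 - JJ _ := by
    ext i j
    simp only [Z]
    rw [ZY_mul hn hK hz hz, szz]
    simp only [circulant_apply, Matrix.sub_apply, Matrix.smul_apply, Matrix.one_apply, JJ, smul_eq_mul,
      ← sub_eq_zero (a := i) (b := j)]
    obtain ⟨l, u, h⟩ := exists_pt (i - j)
    by_cases h0 : i - j = 0
    · simp only [h0, cb_zero, eta_zero, if_true, hV2]; ring
    · have hl : l ≠ 0 := by rintro rfl; simp [h] at h0
      simp only [h0, if_false]
      rw [h, cb_pt _ _ _ hl, hq]
      linear_combination (Fintype.card K : ℚ) * (eta l * eta l) * zz u +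
        (Fintype.card K : ℚ) * eta_sq hl
  have YY : Y * Y = V • 1 - JJ _ := by
    ext i j
    simp only [Y]
    rw [ZY_mul hn hK hy hy, syy]
    simp only [circulant_apply, Matrix.sub_apply, Matrix.smul_apply, Matrix.one_apply, JJ, smul_eq_mul,
      ← sub_eq_zero (a := i) (b := j)]
    obtain ⟨l, u, h⟩ := exists_pt (i - j)
    by_cases h0 : i - j = 0
    · simp only [h0, cb_zero, eta_zero, if_true, hV2]; ring
    · have hl : l ≠ 0 := by rintro rfl; simp [h] at h0
      simp only [h0, if_false]
      rw [h, cb_pt _ _ _ hl, neg_mul_neg, hq]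
      linear_combination (Fintype.card K : ℚ) * (eta l * eta l) * yy u +
        (Fintype.card K : ℚ) * eta_sq hl
  have AA : A * A = (1/2 : ℚ) • (V • 1 + JJ _) + (1/2 : ℚ) • (Z * Y) := by
    ext i j
    simp only [A, Z, Y]
    rw [AB_mul hn hK, ZY_mul hn hK hz hy, szy, sa, saa]
    simp only [circulant_apply, Matrix.add_apply, Matrix.smul_apply, Matrix.one_apply, JJ, smul_eq_mul,
      ← sub_eq_zero (a := i) (b := j)]
    obtain ⟨l, u, h⟩ := exists_pt (i - j)
    by_cases h0 : i - j = 0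
    · simp only [h0, cb_zero, eta_zero, if_true, hV2, saa]; ring
    · have hl : l ≠ 0 := by rintro rfl; simp [h] at h0
      simp only [h0, if_false]
      rw [h, cb_pt _ _ _ hl, cb_pt _ _ _ hl, cb_pt _ _ _ hl, mul_neg, hq, aa]
      linear_combination (Fintype.card K : ℚ) / 2 * z u * y u * eta_sq hl
  have BB : B * B = (1/2 : ℚ) • (V • 1 + JJ _) - (1/2 : ℚ) • (Z * Y) := by
    ext i j
    simp only [B, Z, Y]
    rw [AB_mul hn hK, ZY_mul hn hK hz hy, szy, sb, sbb]
    simp only [circulant_apply, Matrix.add_apply, Matrix.sub_apply, Matrix.smul_apply, Matrix.one_apply, JJ, smul_eq_mul,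
      ← sub_eq_zero (a := i) (b := j)]
    obtain ⟨l, u, h⟩ := exists_pt (i - j)
    by_cases h0 : i - j = 0
    · simp only [h0, cb_zero, eta_zero, if_true, hV2, sbb]; ring
    · have hl : l ≠ 0 := by rintro rfl; simp [h] at h0
      simp only [h0, if_false]
      rw [h, cb_pt _ _ _ hl, cb_pt _ _ _ hl, cb_pt _ _ _ hl, mul_neg, hq, bb]
      linear_combination -(Fintype.card K : ℚ) / 2 * z u * y u * eta_sq hl
  have F12 : F1 * F2 = 0 := by
    rw [hF1, hF2]
    simp only [Matrix.smul_mul, Matrix.mul_smul, add_mul, mul_sub, ZZ, YY, YZ]; module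
  have F21 : F2 * F1 = 0 := by rw [← F12]; exact circulant_mul_comm _ _
  have F11 : F1 * F1 = (1/2 : ℚ) • (V • 1 - JJ _) + (1/2 : ℚ) • (Z * Y) := by
    rw [hF1]
    simp only [Matrix.smul_mul, Matrix.mul_smul, add_mul, mul_add, ZZ, YY, YZ]; module
  have F22 : F2 * F2 = (1/2 : ℚ) • (V • 1 - JJ _) - (1/2 : ℚ) • (Z * Y) := by
    rw [hF2]
    simp only [Matrix.smul_mul, Matrix.mul_smul, sub_mul, mul_sub, ZZ, YY, YZ]; module
  -- pm property
  have val : ∀ v : K × K,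
      (cb a (fun _ => 1) v = 0 ∧ cb f2 eta v = 0 ∧ (cb b (fun _ => 1) v = 1 ∨ cb b (fun _ => 1) v = -1) ∧
        (cb f1 eta v = 1 ∨ cb f1 eta v = -1)) ∨
      (cb b (fun _ => 1) v = 0 ∧ cb f1 eta v = 0 ∧ (cb a (fun _ => 1) v = 1 ∨ cb a (fun _ => 1) v = -1) ∧
        (cb f2 eta v = 1 ∨ cb f2 eta v = -1)) ∨
      (cb a (fun _ => 1) v = 1 ∧ cb b (fun _ => 1) v = 1 ∧ cb f1 eta v = 0 ∧ cb f2 eta v = 0) := by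
    intro v
    obtain ⟨l, u, rfl⟩ := exists_pt v
    by_cases hl : l = 0
    · right; right
      subst hl
      simp [cb_zero, eta_zero, sa, sb, -Fintype.sum_option]
    · simp only [cb_pt _ _ _ hl, mul_one, f1, f2]
      rcases cases u with ⟨h1, h2, h3⟩ | ⟨h1, h2, h3⟩
      · left
        refine ⟨h2, by rw [h1]; ring, h3, ?_⟩
        rw [h1]
        rcases py u with h | h <;> rcases eta_pm hl with h' | h' <;> rw [h, h'] <;> norm_num
      · right; left
        refine ⟨h2, by rw [h1]; ring, h3, ?_⟩
        rw [h1]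
        rcases py u with h | h <;> rcases eta_pm hl with h' | h' <;> rw [h, h'] <;> norm_num
  have val' : ∀ i j, (A i j = 0 ∧ F2 i j = 0 ∧ (B i j = 1 ∨ B i j = -1) ∧ (F1 i j = 1 ∨ F1 i j = -1)) ∨
     (B i j = 0 ∧ F1 i j = 0 ∧ (A i j = 1 ∨ A i j = -1) ∧ (F2 i j = 1 ∨ F2 i j = -1)) ∨
     (A i j = 1 ∧ B i j = 1 ∧ F1 i j = 0 ∧ F2 i j = 0) := fun i j => val (i - j)
  have symgl : ∀ (f : K → ℚ), (∀ x, f (-x) = f x) → ∀ a : Option K → ℚ,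
      (circulant (cb a f))ᵀ = circulant (cb a f) := by
    intro f hf a
    rw [transpose_circulant]
    congr 1
    ext v
    obtain ⟨l, u, rfl⟩ := exists_pt v
    by_cases hl : l = 0
    · simp [hl]
    · rw [← neg_smul, cb_pt _ _ _ hl, cb_pt _ _ _ (neg_ne_zero.2 hl), hf]
  have eneg : ∀ x : K, eta (-x) = eta x := fun x => by
    rw [show -x = (-1) * x by ring, eta_mul, hn, one_mul]
  have tA : Aᵀ = A := symgl _ (fun _ => rfl) _
  have tB : Bᵀ = B := symgl _ (fun _ => rfl) _
  have tF1 : F1ᵀ = F1 := symgl _ eneg _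
  have tF2 : F2ᵀ = F2 := symgl _ eneg _
  clear_value A B F1 F2 Z Y
  refine ⟨K × K, inferInstance, inferInstance, A - F1, A + F1, B - F2, -(B + F2),
    by rw [Fintype.card_prod], ?_⟩
  constructor
  · intro i j; rcases val' i j with ⟨h1, h2, h3 | h3, h4 | h4⟩ | ⟨h1, h2, h3 | h3, h4 | h4⟩ | ⟨h1, h2, h3, h4⟩ <;> simp [h1, h2, h3, h4]
  · intro i j; rcases val' i j with ⟨h1, h2, h3 | h3, h4 | h4⟩ | ⟨h1, h2, h3 | h3, h4 | h4⟩ | ⟨h1, h2, h3, h4⟩ <;> simp [h1, h2, h3, h4]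
  · intro i j; rcases val' i j with ⟨h1, h2, h3 | h3, h4 | h4⟩ | ⟨h1, h2, h3 | h3, h4 | h4⟩ | ⟨h1, h2, h3, h4⟩ <;> simp [h1, h2, h3, h4]
  · intro i j; rcases val' i j with ⟨h1, h2, h3 | h3, h4 | h4⟩ | ⟨h1, h2, h3 | h3, h4 | h4⟩ | ⟨h1, h2, h3, h4⟩ <;> simp [h1, h2, h3, h4]
  · simp [tA, tF1]
  · simp [tA, tF1]
  · simp [tB, tF2]
  · simp [tB, tF2, add_comm]
  · simp only [sub_mul, mul_add, F1A, AA, F11]; module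
  · simp only [sub_mul, mul_sub, AB, AF2, F1B, F12]; module
  · simp only [add_mul, mul_sub, AB, AF2, F1B, F12]; module
  · simp only [sub_mul, mul_neg, mul_add, AB, AF2, F1B, F12]; module
  · simp only [add_mul, mul_neg, mul_add, AB, AF2, F1B, F12]; module
  · simp only [sub_mul, mul_neg, mul_add, F2B, BB, F22]; module
  · rw [← hV]
    simp only [sub_mul, add_mul, neg_mul, mul_neg, mul_add, mul_sub, F1A, F2B, AA, F11, BB, F22]; module

end prime
end PH

set_option linter.unusedSectionVars false
namespace PH
open Matrix

section prime
variable {K : Type} [Field K] [Fintype K] [DecidableEq K] {p : ℕ} [Fact p.Prime] [Algebra (ZMod p) K]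

lemma eta_smul (hp : p % 2 = 1) (hc : Fintype.card K = p * p) (hK : ringChar K ≠ 2) {k : ZMod p} (hk : k ≠ 0) (x : K) :
    eta (k • x) = eta x := by
  have h1 : eta (algebraMap (ZMod p) K k) = 1 := by
    have hk' : algebraMap (ZMod p) K k ≠ 0 := by simpa using hk
    have : IsSquare (algebraMap (ZMod p) K k) := by
      rw [FiniteField.isSquare_iff hK hk', hc]
      obtain ⟨t, ht⟩ : ∃ t, p = 2 * t + 1 := ⟨p / 2, by omega⟩
      have e : p * p / 2 = (p - 1) * (t + 1) := by
        rw [ht]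
        have : (2 * t + 1) * (2 * t + 1) = 2 * ((2 * t) * (t + 1)) + 1 := by ring
        rw [this, Nat.add_sub_cancel]; omega
      rw [e, pow_mul, ← map_pow, ZMod.pow_card_sub_one_eq_one hk, map_one, one_pow]
    have := (quadraticChar_one_iff_isSquare hk').2 this
    unfold eta; rw [this]; norm_num
  rw [Algebra.smul_def, eta_mul, h1, one_mul]

lemma exists_z (hp : p % 2 = 1) (hc : Fintype.card K = p * p) (hn : eta (-1 : K) = 1) (hK : ringChar K ≠ 2)
    (s : ℚ) (hs : s = 1 ∨ s = -1) (ha : ∃ a : K, eta a = s) :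
    ∃ z : Option K → ℚ, (∀ u, z u = 1 ∨ z u = -1) ∧
      ∀ u, ∑ w, z w * eta (Bf (pt w) (pt u)) = (s * p) * z u := by
  have hp0 : p.Prime := Fact.out
  obtain ⟨a, ha⟩ := ha
  have ss : s * s = 1 := by rcases hs with h | h <;> rw [h] <;> norm_num
  have ha0 : a ≠ 0 := by
    rintro rfl; rw [eta_zero] at ha; rw [← ha] at ss; norm_num at ss
  obtain ⟨b, hb⟩ : ∃ b : K, ∀ k : ZMod p, b ≠ k • a := by
    by_contra! h
    have : Function.Surjective fun k : ZMod p => k • a := fun b => by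
      obtain ⟨k, hk⟩ := h b; exact ⟨k, hk.symm⟩
    have := Fintype.card_le_of_surjective _ this
    rw [hc, ZMod.card] at this
    nlinarith [hp0.two_le]
  let ψ : ZMod p × ZMod p → K := fun x => x.1 • a + x.2 • b
  have hinj : Function.Injective ψ := by
    rintro ⟨i, j⟩ ⟨i', j'⟩ h
    simp only [ψ] at h
    have hj : j = j' := by
      by_contra hne
      have h0 : j - j' ≠ 0 := sub_ne_zero.2 hne
      have e : (j - j') • b = (i' - i) • a := by
        rw [sub_smul, sub_smul, sub_eq_sub_iff_add_eq_add, add_comm, h, add_comm]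
      refine hb ((j - j')⁻¹ * (i' - i)) ?_
      rw [mul_smul, ← e, smul_smul, inv_mul_cancel₀ h0, one_smul]
    subst hj
    have : (i - i') • a = 0 := by rw [sub_smul, sub_eq_zero]; exact add_right_cancel h
    have : i = i' := by
      rcases smul_eq_zero.1 this with h | h
      · exact sub_eq_zero.1 h
      · exact absurd h ha0
    rw [this]
  have hbij : Function.Bijective ψ := by
    rw [Fintype.bijective_iff_injective_and_card]
    refine ⟨hinj, ?_⟩
    rw [Fintype.card_prod, ZMod.card, hc]
  let E : ZMod p × ZMod p ≃ K := Equiv.ofBijective ψ hbij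
  have hE : ∀ x, E x = x.1 • a + x.2 • b := fun x => rfl
  let S : ZMod p → ℚ := fun r => ∑ i : ZMod p, eta (i • a + r • b)
  have hpq : (p : ℚ) - 1 ≠ 0 := by
    have : (2 : ℚ) ≤ p := by exact_mod_cast hp0.two_le
    linarith
  have S0 : S 0 = (p - 1) * s := by
    simp only [S, zero_smul, add_zero]
    rw [← Finset.add_sum_erase _ _ (Finset.mem_univ (0 : ZMod p)), zero_smul, eta_zero, zero_add]
    rw [Finset.sum_congr rfl fun i hi => by
      rw [eta_smul hp hc hK (Finset.ne_of_mem_erase hi), ha]]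
    rw [Finset.sum_const, Finset.card_erase_of_mem (Finset.mem_univ _), Finset.card_univ, ZMod.card,
      nsmul_eq_mul, Nat.cast_sub hp0.one_le]
    simp
  have S1 : ∀ r, r ≠ 0 → S r = S 1 := by
    intro r hr
    simp only [S]
    refine Fintype.sum_equiv (Equiv.mulLeft₀ r⁻¹ (inv_ne_zero hr)) _ _ fun i => ?_
    rw [← eta_smul hp hc hK hr ((Equiv.mulLeft₀ r⁻¹ (inv_ne_zero hr)) i • a + (1 : ZMod p) • b)]
    congr 1
    have e3 : (Equiv.mulLeft₀ r⁻¹ (inv_ne_zero hr)) i = r⁻¹ * i := rfl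
    rw [e3]
    simp only [smul_add, smul_smul, mul_one]
    rw [← mul_assoc, mul_inv_cancel₀ hr, one_mul]
  have Ssum : ∑ r, S r = 0 := by
    rw [← eta_sum hK]
    simp only [S]
    rw [Finset.sum_comm, ← Fintype.sum_prod_type' (fun (i r : ZMod p) => eta (i • a + r • b))]
    exact Fintype.sum_equiv E _ _ fun x => rfl
  have S1v : S 1 = - s := by
    rw [← Finset.add_sum_erase _ _ (Finset.mem_univ (0 : ZMod p)), S0,
      Finset.sum_congr rfl fun i hi => S1 i (Finset.ne_of_mem_erase hi)] at Ssum
    rw [Finset.sum_const, Finset.card_erase_of_mem (Finset.mem_univ _), Finset.card_univ, ZMod.card,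
      nsmul_eq_mul, Nat.cast_sub hp0.one_le] at Ssum
    push_cast at Ssum
    have : ((p : ℚ) - 1) * (s + S 1) = 0 := by linarith
    have := (mul_eq_zero.1 this).resolve_left hpq
    linarith
  have Sv : ∀ r, S r = s * p * (if r = 0 then 1 else 0) - s := by
    intro r
    split_ifs with h
    · rw [h, S0]; ring
    · rw [S1 r h, S1v]; ring
  obtain ⟨g0, hg1, -, hg2⟩ := exists_sign (Finset.univ : Finset (ZMod p))
    (by rw [Finset.card_univ, ZMod.card]; exact hp)
  let g : ZMod p → ℚ := fun j => s * g0 j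
  have hg : ∀ j, g j = 1 ∨ g j = -1 := by
    intro j
    rcases hs with h | h <;> rcases hg1 j (Finset.mem_univ _) with h' | h' <;> simp [g, h, h']
  have sg : ∑ j, g j = s := by simp only [g]; rw [← Finset.mul_sum, hg2, mul_one]
  refine ⟨fun u => match u with | none => 1 | some c => g (E.symm c).2, ?_, ?_⟩
  · rintro (_ | c)
    · simp
    · exact hg _
  have e1 : eta (1 : K) = 1 := by simp [eta]
  rintro (_ | d)
  · simp only [Fintype.sum_option, pt, Bf]
    simp only [mul_one, one_mul, mul_zero, zero_mul, sub_zero, eta_zero, e1, zero_add]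
    rw [← Fintype.sum_equiv E (fun x => g x.2) _ (fun x => by simp)]
    rw [Fintype.sum_prod_type]
    simp only [sg, Finset.sum_const, Finset.card_univ, ZMod.card, nsmul_eq_mul]
    ring
  · simp only [Fintype.sum_option, pt, Bf]
    simp only [mul_one, one_mul, zero_mul, zero_sub, hn]
    rw [← Fintype.sum_equiv E (fun x => g x.2 * eta (d - E x)) _ (fun x => by simp)]
    obtain ⟨⟨i0, j0⟩, rfl⟩ := E.surjective d
    rw [Fintype.sum_prod_type_right]
    have key : ∀ j, ∑ i, g j * eta (E (i0, j0) - E (i, j)) = g j * S (j0 - j) := by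
      intro j
      rw [← Finset.mul_sum]
      congr 1
      refine Fintype.sum_equiv (Equiv.subLeft i0) _ _ fun i => ?_
      simp only [hE, Equiv.subLeft_apply, sub_smul]
      congr 1; abel
    simp only [key, Sv, Equiv.symm_apply_apply]
    have : ∀ j, g j * (s * p * (if j0 - j = 0 then 1 else 0) - s) =
        (if j0 = j then s * p * g j else 0) - s * g j := by
      intro j; simp only [sub_eq_zero]; split_ifs <;> ring
    simp only [this, Finset.sum_sub_distrib, Finset.sum_ite_eq, Finset.mem_univ, if_true,
      ← Finset.mul_sum, sg]
    linear_combination -ss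
end prime

lemma typeH_prime (p : ℕ) (hp : p.Prime) (h2 : p % 2 = 1) : TypeH (p ^ 4) := by
  classical
  haveI : Fact p.Prime := ⟨hp⟩
  let K := GaloisField p 2
  haveI : Fintype K := Fintype.ofFinite K
  have hc : Fintype.card K = p * p := by
    rw [← Nat.card_eq_fintype_card, GaloisField.card p 2 (by norm_num), sq]
  have hK : ringChar K ≠ 2 := by
    rw [ringChar.eq K p]; omega
  have h4 : Fintype.card K % 4 = 1 := by
    rw [hc, Nat.mul_mod]
    have : p % 4 = 1 ∨ p % 4 = 3 := by omega
    rcases this with h | h <;> rw [h]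
  have hn : eta (-1 : K) = 1 := by
    have : IsSquare (-1 : K) := FiniteField.isSquare_neg_one_iff.2 (by omega)
    have := (quadraticChar_one_iff_isSquare (by simp : (-1 : K) ≠ 0)).2 this
    unfold eta; rw [this]; norm_num
  obtain ⟨b, hb⟩ := quadraticChar_exists_neg_one hK
  obtain ⟨z, hz1, hz2⟩ := exists_z h2 hc hn hK 1 (Or.inl rfl) ⟨1, by simp [eta]⟩
  obtain ⟨y, hy1, hy2⟩ := exists_z h2 hc hn hK (-1) (Or.inr rfl) ⟨b, by unfold eta; rw [hb]; norm_num⟩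
  have := prime_core (q := (p : ℚ)) hn hK h4 (by rw [hc]; push_cast; ring) hz1 hy1
    (by intro u; rw [hz2]; ring) (by intro u; rw [hy2]; ring)
  rw [hc] at this
  convert this using 1; ring

lemma typeH_odd (m : ℕ) : m % 2 = 1 → TypeH (m ^ 4) := by
  induction m using induction_on_primes with
  | zero => intro h; simp at h
  | one => intro _; simpa using typeH_one
  | prime_mul p a hp ih =>
    intro h
    have h1 : p % 2 = 1 := by
      rcases Nat.mod_two_eq_zero_or_one p with h' | h'
      · rw [Nat.mul_mod, h'] at h; simp at h
      · exact h'
    have h2 : a % 2 = 1 := by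
      rcases Nat.mod_two_eq_zero_or_one a with h' | h'
      · rw [Nat.mul_mod, h'] at h; simp at h
      · exact h'
    rw [mul_pow]
    exact (typeH_prime p hp h1).mul (ih h2)
end PH

set_option linter.unusedSectionVars false
set_option linter.unusedSimpArgs false
namespace PH
open Matrix
open scoped Kronecker

lemma IsPM.neg {m n : Type*} {A : Matrix m n ℚ} (h : IsPM A) : IsPM (-A) := by
  intro i j
  rcases h i j with h | h <;> simp [h]

lemma IsPM.tr {m n : Type*} {A : Matrix m n ℚ} (h : IsPM A) : IsPM Aᵀ := fun i j => h j i

lemma IsPM.blocks {a b c d : Type*} {A : Matrix a b ℚ} {B : Matrix a d ℚ} {C : Matrix c b ℚ}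
    {D : Matrix c d ℚ} (hA : IsPM A) (hB : IsPM B) (hC : IsPM C) (hD : IsPM D) :
    IsPM (fromBlocks A B C D) := by
  rintro (i | i) (j | j)
  · exact hA i j
  · exact hB i j
  · exact hC i j
  · exact hD i j

lemma goethals_seidel {κ : Type} [Fintype κ] [DecidableEq κ] {A B C D R : Matrix κ κ ℚ}
    (P : Matrix κ κ ℚ → Prop) (hP : ∀ X Y, P X → P Y → X * Y = Y * X)
    (hPt : ∀ X, P X → P Xᵀ) (hR : ∀ X, P X → R * X = Xᵀ * R) (hRR : R * R = 1) (hRt : Rᵀ = R)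
    (hpm : ∀ X, IsPM X → IsPM (X * R))
    (hA : P A) (hB : P B) (hC : P C) (hD : P D)
    (pA : IsPM A) (pB : IsPM B) (pC : IsPM C) (pD : IsPM D) (c : ℚ) (hc : c = 4 * Fintype.card κ)
    (hsum : A * Aᵀ + B * Bᵀ + C * Cᵀ + D * Dᵀ = c • 1) : IsHad (4 * Fintype.card κ) := by
  let H := fromBlocks (fromBlocks A (B * R) (-(B * R)) A)
    (fromBlocks (C * R) (D * R) (Dᵀ * R) (-(Cᵀ * R)))
    (fromBlocks (-(C * R)) (-(Dᵀ * R)) (-(D * R)) (Cᵀ * R))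
    (fromBlocks A (Bᵀ * R) (-(Bᵀ * R)) A)
  refine IsHad.of_fintype _ H ?_ ?_ ?_
  · simp only [Fintype.card_sum]; ring
  · exact IsPM.blocks (IsPM.blocks pA (hpm _ pB) (hpm _ pB).neg pA)
      (IsPM.blocks (hpm _ pC) (hpm _ pD) (hpm _ pD.tr) (hpm _ pC.tr).neg)
      (IsPM.blocks (hpm _ pC).neg (hpm _ pD.tr).neg (hpm _ pD).neg (hpm _ pC.tr))
      (IsPM.blocks pA (hpm _ pB.tr) (hpm _ pB.tr).neg pA)
  · have cast : ((4 * Fintype.card κ : ℕ) : ℚ) = c := by rw [hc]; push_cast; rfl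
    rw [cast]
    have hRr : ∀ X, P X → ∀ Y : Matrix κ κ ℚ, Y * R * X = Y * Xᵀ * R := by
      intro X hX Y; rw [mul_assoc, hR X hX, mul_assoc]
    have hRr' : ∀ X, P X → ∀ Y : Matrix κ κ ℚ, Y * R * Xᵀ = Y * X * R := by
      intro X hX Y; rw [hRr _ (hPt X hX), transpose_transpose]
    have hR' : ∀ X, P X → R * Xᵀ = X * R := by
      intro X hX; rw [hR _ (hPt X hX), transpose_transpose]
    have hRR' : ∀ Y : Matrix κ κ ℚ, Y * R * R = Y := by
      intro Y; rw [mul_assoc, hRR, mul_one]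
    have r1 := hRr A hA
    have r2 := hRr B hB
    have r3 := hRr C hC
    have r4 := hRr D hD
    have r5 := hRr' A hA
    have r6 := hRr' B hB
    have r7 := hRr' C hC
    have r8 := hRr' D hD
    have q1 := hR A hA
    have q2 := hR B hB
    have q3 := hR C hC
    have q4 := hR D hD
    have q5 := hR' A hA
    have q6 := hR' B hB
    have q7 := hR' C hC
    have q8 := hR' D hD
    have hA' := hPt A hA
    have hB' := hPt B hB
    have hC' := hPt C hC
    have hD' := hPt D hD
    have k1 := hP B A hB hA
    have k2 := hP C A hC hA
    have k3 := hP D A hD hA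
    have k4 := hP C B hC hB
    have k5 := hP D B hD hB
    have k6 := hP D C hD hC
    have k7 := hP Aᵀ A hA' hA
    have k8 := hP Aᵀ B hA' hB
    have k9 := hP Aᵀ C hA' hC
    have k10 := hP Aᵀ D hA' hD
    have k11 := hP Bᵀ A hB' hA
    have k12 := hP Bᵀ B hB' hB
    have k13 := hP Bᵀ C hB' hC
    have k14 := hP Bᵀ D hB' hD
    have k15 := hP Cᵀ A hC' hA
    have k16 := hP Cᵀ B hC' hB
    have k17 := hP Cᵀ C hC' hC
    have k18 := hP Cᵀ D hC' hD
    have k19 := hP Dᵀ A hD' hA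
    have k20 := hP Dᵀ B hD' hB
    have k21 := hP Dᵀ C hD' hC
    have k22 := hP Dᵀ D hD' hD
    have k23 := hP Bᵀ Aᵀ hB' hA'
    have k24 := hP Cᵀ Aᵀ hC' hA'
    have k25 := hP Dᵀ Aᵀ hD' hA'
    have k26 := hP Cᵀ Bᵀ hC' hB'
    have k27 := hP Dᵀ Bᵀ hD' hB'
    have k28 := hP Dᵀ Cᵀ hD' hC'
    have one : c • (1 : Matrix ((κ ⊕ κ) ⊕ (κ ⊕ κ)) ((κ ⊕ κ) ⊕ (κ ⊕ κ)) ℚ) =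
        fromBlocks (fromBlocks (c • 1) 0 0 (c • 1)) (fromBlocks 0 0 0 0) (fromBlocks 0 0 0 0)
          (fromBlocks (c • 1) 0 0 (c • 1)) := by
      simp only [← fromBlocks_one, fromBlocks_smul, smul_zero, fromBlocks_zero]
    rw [one, ← hsum]
    simp only [H, fromBlocks_transpose, fromBlocks_multiply, fromBlocks_add, transpose_neg, transpose_mul,
      hRt, transpose_transpose, q1, q2, q3, q4, q5, q6, q7, q8, neg_mul, mul_neg, neg_neg, ← mul_assoc,
      r1, r2, r3, r4, r5, r6, r7, r8, hRR',
      k1, k2, k3, k4, k5, k6, k7, k8, k9, k10, k11, k12, k13, k14, k15, k16, k17, k18, k19, k20,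
      k21, k22, k23, k24, k25, k26, k27, k28]
    clear r1 r2 r3 r4 r5 r6 r7 r8 q1 q2 q3 q4 q5 q6 q7 q8 k1 k2 k3 k4 k5 k6 k7 k8 k9 k10 k11 k12
    congr 1 <;> congr 1 <;> abel
end PH

set_option linter.unusedSectionVars false
set_option linter.unusedSimpArgs false
namespace PH
open Matrix
open scoped Kronecker

lemma oneof (a b c d : ℤ) (h : a.natAbs + b.natAbs + c.natAbs + d.natAbs = 1) :
    ((a = 1 ∨ a = -1) ∧ b = 0 ∧ c = 0 ∧ d = 0) ∨ ((b = 1 ∨ b = -1) ∧ a = 0 ∧ c = 0 ∧ d = 0) ∨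
    ((c = 1 ∨ c = -1) ∧ a = 0 ∧ b = 0 ∧ d = 0) ∨ ((d = 1 ∨ d = -1) ∧ a = 0 ∧ b = 0 ∧ c = 0) := by
  have h' : (a.natAbs = 1 ∧ b.natAbs = 0 ∧ c.natAbs = 0 ∧ d.natAbs = 0) ∨
    (b.natAbs = 1 ∧ a.natAbs = 0 ∧ c.natAbs = 0 ∧ d.natAbs = 0) ∨
    (c.natAbs = 1 ∧ a.natAbs = 0 ∧ b.natAbs = 0 ∧ d.natAbs = 0) ∨
    (d.natAbs = 1 ∧ a.natAbs = 0 ∧ b.natAbs = 0 ∧ c.natAbs = 0) := by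
    generalize a.natAbs = a at *
    generalize b.natAbs = b at *
    generalize c.natAbs = c at *
    generalize d.natAbs = d at *
    omega
  simp only [Int.natAbs_eq_zero, Int.natAbs_eq_iff, Nat.cast_one, Nat.cast_zero, neg_zero, or_self] at h'
  exact h'

lemma kron_tr {a b c d : Type*} (A : Matrix a b ℚ) (B : Matrix c d ℚ) :
    (A ⊗ₖ B)ᵀ = Aᵀ ⊗ₖ Bᵀ := by ext i j; simp [Matrix.kroneckerMap_apply]

lemma pm_of_oneof (a b c d : ℤ) (h : a.natAbs + b.natAbs + c.natAbs + d.natAbs = 1) (x y z w : ℚ)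
    (hx : x = 1 ∨ x = -1) (hy : y = 1 ∨ y = -1) (hz : z = 1 ∨ z = -1) (hw : w = 1 ∨ w = -1) :
    (a : ℚ) * x + b * y + c * z + d * w = 1 ∨ (a : ℚ) * x + b * y + c * z + d * w = -1 := by
  rcases oneof a b c d h with ⟨h1 | h1, h2, h3, h4⟩ | ⟨h1 | h1, h2, h3, h4⟩ | ⟨h1 | h1, h2, h3, h4⟩ |
    ⟨h1 | h1, h2, h3, h4⟩ <;> subst h1 h2 h3 h4 <;> simp <;> 
    first | exact hx | exact hx.symm | exact hy | exact hz | exact hw | skip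
  all_goals first
    | (rcases hx with h | h <;> simp [h]; done)
    | (rcases hy with h | h <;> simp [h]; done)
    | (rcases hz with h | h <;> simp [h]; done)
    | (rcases hw with h | h <;> simp [h]; done)

section
variable {t : ℕ} [NeZero t] {ι : Type} [Fintype ι] [DecidableEq ι] {h0 h1 h2 h3 : Matrix ι ι ℚ}

/-- circulant matrix of an integer sequence, with rational entries -/
def circ (f : ZMod t → ℤ) : Matrix (ZMod t) (ZMod t) ℚ := circulant (fun x => (f x : ℚ))

lemma circ_neg (f : ZMod t → ℤ) : circ (-f) = - circ f := by
  ext i j; simp [circ]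

lemma circ_comm (f g : ZMod t → ℤ) : circ f * circ g = circ g * circ f :=
  circulant_mul_comm _ _

lemma circ_tr (f : ZMod t → ℤ) : (circ f)ᵀ = circ (fun x => f (-x)) := by
  simp [circ, transpose_circulant]

variable (h0 h1 h2 h3) in
def kk (a b c d : ZMod t → ℤ) : Matrix (ZMod t × ι) (ZMod t × ι) ℚ :=
  circ a ⊗ₖ h0 + circ b ⊗ₖ h1 + circ c ⊗ₖ h2 + circ d ⊗ₖ h3

lemma kk_pm (q : Quad ι h0 h1 h2 h3) (a b c d : ZMod t → ℤ)
    (h : ∀ x, (a x).natAbs + (b x).natAbs + (c x).natAbs + (d x).natAbs = 1) :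
    IsPM (kk h0 h1 h2 h3 a b c d) := by
  intro i j
  simp only [kk, circ, Matrix.add_apply, kroneckerMap_apply, circulant_apply]
  exact pm_of_oneof _ _ _ _ (h _) _ _ _ _ (q.pm0 _ _) (q.pm1 _ _) (q.pm2 _ _) (q.pm3 _ _)

lemma kk_tr (q : Quad ι h0 h1 h2 h3) (a b c d : ZMod t → ℤ) :
    (kk h0 h1 h2 h3 a b c d)ᵀ =
      kk h0 h1 h2 h3 (fun x => a (-x)) (fun x => b (-x)) (fun x => c (-x)) (fun x => d (-x)) := by
  simp only [kk, transpose_add, kron_tr, circ_tr, q.s0, q.s1, q.s2, q.s3]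

lemma kk_comm (q : Quad ι h0 h1 h2 h3) (a b c d a' b' c' d' : ZMod t → ℤ) :
    kk h0 h1 h2 h3 a b c d * kk h0 h1 h2 h3 a' b' c' d' =
      kk h0 h1 h2 h3 a' b' c' d' * kk h0 h1 h2 h3 a b c d := by
  simp only [kk, add_mul, mul_add, ← mul_kronecker_mul, q.m01, q.m02, q.m12, q.m03, q.m13, q.m23,
    q.m10, q.m20, q.m21, q.m30, q.m31, q.m32,
    circ_comm a' a, circ_comm a' b, circ_comm a' c, circ_comm a' d,
    circ_comm b' a, circ_comm b' b, circ_comm b' c, circ_comm b' d,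
    circ_comm c' a, circ_comm c' b, circ_comm c' c, circ_comm c' d,
    circ_comm d' a, circ_comm d' b, circ_comm d' c, circ_comm d' d]
  abel

lemma kk_sum (q : Quad ι h0 h1 h2 h3) (a b c d : ZMod t → ℤ) :
    kk h0 h1 h2 h3 a b c d * (kk h0 h1 h2 h3 a b c d)ᵀ
    + kk h0 h1 h2 h3 b (-a) (-d) c * (kk h0 h1 h2 h3 b (-a) (-d) c)ᵀ
    + kk h0 h1 h2 h3 c d (-a) (-b) * (kk h0 h1 h2 h3 c d (-a) (-b))ᵀ
    + kk h0 h1 h2 h3 d (-c) b (-a) * (kk h0 h1 h2 h3 d (-c) b (-a))ᵀ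
    = (circ a * (circ a)ᵀ + circ b * (circ b)ᵀ + circ c * (circ c)ᵀ + circ d * (circ d)ᵀ) ⊗ₖ
      (h0 * h0 + h1 * h1 + h2 * h2 + h3 * h3) := by
  simp only [kk, transpose_add, kron_tr, q.s0, q.s1, q.s2, q.s3,
    circ_neg, transpose_neg, add_mul, mul_add, ← mul_kronecker_mul, q.m01, q.m02, q.m12, q.m03,
    q.m13, q.m23, q.m10, q.m20, q.m21, q.m30, q.m31, q.m32, neg_mul, mul_neg, neg_neg,
    neg_kron, kron_neg, add_kronecker, kronecker_add]
  abel

/-- the reversal permutation matrix -/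
def revM (t : ℕ) : Matrix (ZMod t) (ZMod t) ℚ := fun i j => if i = -j then 1 else 0

lemma revM_tr : (revM t)ᵀ = revM t := by
  ext i j; simp only [revM, transpose_apply]
  congr 1; exact propext ⟨fun h => by rw [h, neg_neg], fun h => by rw [h, neg_neg]⟩

lemma mul_revM (X : Matrix (ZMod t) (ZMod t) ℚ) (i j) : (X * revM t) i j = X i (-j) := by
  simp [revM, mul_apply]

lemma revM_mul (X : Matrix (ZMod t) (ZMod t) ℚ) (i j) : (revM t * X) i j = X (-i) j := by
  have : ∀ k : ZMod t, (i = -k) = (-i = k) := fun k => propext neg_eq_iff_eq_neg.symm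
  simp [revM, mul_apply, this]

lemma revM_sq : revM t * revM t = 1 := by
  ext i j; rw [mul_revM]; simp [revM, one_apply]

lemma revM_circ (f : ZMod t → ℤ) : revM t * circ f = (circ f)ᵀ * revM t := by
  ext i j; rw [revM_mul, mul_revM]; simp only [circ, circulant_apply, transpose_apply]
  congr 2; ring

lemma kron_rev_apply (X : Matrix (ZMod t × ι) (ZMod t × ι) ℚ) (i j) :
    (X * (revM t ⊗ₖ (1 : Matrix ι ι ℚ))) i j = X i (-j.1, j.2) := by
  rw [mul_apply, Fintype.sum_eq_single (-j.1, j.2)]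
  · simp [revM, kroneckerMap_apply]
  · rintro ⟨u, v⟩ h
    simp only [revM, kroneckerMap_apply, one_apply]
    by_cases h1 : u = -j.1
    · by_cases h2 : v = j.2
      · subst h1 h2; exact absurd rfl h
      · simp [h2]
    · simp [h1]

lemma had_gs {v : ℕ} (hv : TypeH v) (a b c d : ZMod t → ℤ)
    (hone : ∀ x, (a x).natAbs + (b x).natAbs + (c x).natAbs + (d x).natAbs = 1)
    (hsum : ∀ k, ∑ x, (a (x + k) * a x + b (x + k) * b x + c (x + k) * c x + d (x + k) * d x)
      = if k = 0 then (t : ℤ) else 0) : IsHad (4 * (t * v)) := by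
  obtain ⟨ι, _, _, h0, h1, h2, h3, hc, q⟩ := hv
  have hcard : Fintype.card (ZMod t × ι) = t * v := by
    rw [Fintype.card_prod, ZMod.card, hc]
  rw [← hcard]
  have hs : circ a * (circ a)ᵀ + circ b * (circ b)ᵀ + circ c * (circ c)ᵀ + circ d * (circ d)ᵀ
      = (t : ℚ) • 1 := by
    ext i j
    have h := hsum (i - j)
    have h' : ∑ x, ((a (x + (i - j)) : ℚ) * a x + b (x + (i - j)) * b x + c (x + (i - j)) * c x
      + d (x + (i - j)) * d x) = if i - j = 0 then (t : ℚ) else 0 := by exact_mod_cast h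
    simp only [circ, Matrix.add_apply, mul_apply, transpose_apply, circulant_apply, ← Finset.sum_add_distrib]
    rw [← Equiv.sum_comp (Equiv.subLeft j)]
    simp only [Equiv.subLeft_apply, sub_sub_cancel]
    rw [Matrix.smul_apply, one_apply]
    simp only [sub_eq_zero] at h'
    rw [smul_eq_mul, mul_ite, mul_one, mul_zero, ← h']
    refine Finset.sum_congr rfl fun x _ => ?_
    rw [show i - (j - x) = x + (i - j) by ring]
  refine goethals_seidel (A := kk h0 h1 h2 h3 a b c d) (B := kk h0 h1 h2 h3 b (-a) (-d) c)
    (C := kk h0 h1 h2 h3 c d (-a) (-b)) (D := kk h0 h1 h2 h3 d (-c) b (-a))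
    (R := revM t ⊗ₖ 1) (P := fun X => ∃ a b c d, X = kk h0 h1 h2 h3 a b c d)
    ?_ ?_ ?_ ?_ ?_ ?_ ⟨_, _, _, _, rfl⟩ ⟨_, _, _, _, rfl⟩ ⟨_, _, _, _, rfl⟩ ⟨_, _, _, _, rfl⟩
    ?_ ?_ ?_ ?_ (t * (4 * v)) ?_ ?_
  · rintro _ _ ⟨_, _, _, _, rfl⟩ ⟨_, _, _, _, rfl⟩; exact kk_comm q _ _ _ _ _ _ _ _
  · rintro _ ⟨_, _, _, _, rfl⟩; exact ⟨_, _, _, _, kk_tr q _ _ _ _⟩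
  · rintro _ ⟨a, b, c, d, rfl⟩
    simp only [kk, transpose_add, kron_tr, q.s0, q.s1, q.s2, q.s3, mul_add, add_mul,
      ← mul_kronecker_mul, one_mul, mul_one, revM_circ]
  · rw [← mul_kronecker_mul, revM_sq, one_mul, one_kronecker_one]
  · rw [kron_tr, revM_tr, transpose_one]
  · intro X hX i j; rw [kron_rev_apply]; exact hX _ _
  · exact kk_pm q _ _ _ _ hone
  · refine kk_pm q _ _ _ _ fun x => ?_
    have := hone x; simp only [Pi.neg_apply, Int.natAbs_neg]; omega
  · refine kk_pm q _ _ _ _ fun x => ?_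
    have := hone x; simp only [Pi.neg_apply, Int.natAbs_neg]; omega
  · refine kk_pm q _ _ _ _ fun x => ?_
    have := hone x; simp only [Pi.neg_apply, Int.natAbs_neg]; omega
  · rw [hcard]; push_cast; ring
  · rw [kk_sum q, hs, q.sum, hc, smul_kronecker, kronecker_smul, one_kronecker_one, smul_smul]
end

lemma had_t1 {v : ℕ} (hv : TypeH v) : IsHad (4 * (1 * v)) :=
  had_gs (t := 1) hv ![1] ![0] ![0] ![0] (by decide) (by decide)
lemma had_t3 {v : ℕ} (hv : TypeH v) : IsHad (4 * (3 * v)) :=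
  had_gs (t := 3) hv ![1,0,0] ![0,1,0] ![0,0,1] ![0,0,0] (by decide +kernel) (by decide +kernel)
lemma had_t5 {v : ℕ} (hv : TypeH v) : IsHad (4 * (5 * v)) :=
  had_gs (t := 5) hv ![1,1,0,0,0] ![0,0,1,0,0] ![0,0,0,1,-1] ![0,0,0,0,0] (by decide +kernel) (by decide +kernel)
lemma had_t7 {v : ℕ} (hv : TypeH v) : IsHad (4 * (7 * v)) :=
  had_gs (t := 7) hv ![1,0,0,0,0,0,0] ![0,1,1,-1,0,0,0] ![0,0,0,0,1,0,1] ![0,0,0,0,0,-1,0]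
    (by decide +kernel) (by decide +kernel)
lemma had_t9 {v : ℕ} (hv : TypeH v) : IsHad (4 * (9 * v)) :=
  had_gs (t := 9) hv ![1,1,0,1,0,0,0,0,0] ![0,0,1,0,-1,0,0,0,0] ![0,0,0,0,0,1,0,0,-1]
    ![0,0,0,0,0,0,-1,1,0] (by decide +kernel) (by decide +kernel)
lemma had_t11 {v : ℕ} (hv : TypeH v) : IsHad (4 * (11 * v)) :=
  had_gs (t := 11) hv ![1,1,0,0,1,0,0,0,0,0,0] ![0,0,1,1,0,-1,0,0,0,0,0]
    ![0,0,0,0,0,0,1,-1,1,-1,-1] ![0,0,0,0,0,0,0,0,0,0,0] (by decide +kernel) (by decide +kernel)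
lemma had_t13 {v : ℕ} (hv : TypeH v) : IsHad (4 * (13 * v)) :=
  had_gs (t := 13) hv ![1,0,1,0,1,0,0,0,0,0,0,0,0] ![0,1,0,1,0,-1,1,0,0,0,0,0,0]
    ![0,0,0,0,0,0,0,1,0,0,0,0,-1] ![0,0,0,0,0,0,0,0,-1,-1,1,1,0] (by decide +kernel) (by decide +kernel)
lemma had_t15 {v : ℕ} (hv : TypeH v) : IsHad (4 * (15 * v)) :=
  had_gs (t := 15) hv ![1,0,1,1,1,-1,0,0,0,0,0,0,0,0,0] ![0,1,0,0,0,0,1,-1,0,0,0,0,0,0,0]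
    ![0,0,0,0,0,0,0,0,1,-1,0,0,0,1,1] ![0,0,0,0,0,0,0,0,0,0,-1,-1,1,0,0]
    (by decide +kernel) (by decide +kernel)

/-- Hadamard matrices of order `4 t m^4`, `t < 16` odd, `m` odd. -/
theorem had_tm (t m : ℕ) (ht : t < 16) (ht' : t % 2 = 1) (hm : m % 2 = 1) : IsHad (4 * (t * m ^ 4)) := by
  have hv := typeH_odd m hm
  interval_cases t <;> first
    | omega | exact had_t1 hv | exact had_t3 hv | exact had_t5 hv
    | exact had_t7 hv | exact had_t9 hv | exact had_t11 hv | exact had_t13 hv | exact had_t15 hv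
end PH

set_option linter.unusedSectionVars false
set_option linter.unusedSimpArgs false
namespace PH
open Matrix
open scoped Kronecker

section alg
variable {ι B : Type} [Fintype ι] [DecidableEq ι] [Ring B] [StarRing B]

lemma dbl_alg (M D W X : Matrix ι ι B) (h1 : D * M = M * D) (h2 : Dᴴ * M = M * Dᴴ)
    (h3 : Dᴴ * D = D * Dᴴ) (w1 : Wᴴ * W = 1) (w2 : W * Wᴴ = 1) (hX : W * X = X * W)
    (hD : W * (D * Dᴴ) = D * Dᴴ * W)
    (hM : M * Mᴴ = X) (hM' : Mᴴ * M = X) :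
    (fromBlocks M D (W * Dᴴ) (-(W * Mᴴ))) * (fromBlocks M D (W * Dᴴ) (-(W * Mᴴ)))ᴴ
      = fromBlocks (X + D * Dᴴ) 0 0 (X + D * Dᴴ) ∧
    (fromBlocks M D (W * Dᴴ) (-(W * Mᴴ)))ᴴ * (fromBlocks M D (W * Dᴴ) (-(W * Mᴴ)))
      = fromBlocks (X + D * Dᴴ) 0 0 (X + D * Dᴴ) := by
  have h1' : Mᴴ * Dᴴ = Dᴴ * Mᴴ := by
    have := congrArg conjTranspose h1; simpa using this
  have h2' : Mᴴ * D = D * Mᴴ := by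
    have := congrArg conjTranspose h2; simpa using this
  have w1' : ∀ Y : Matrix ι ι B, Wᴴ * (W * Y) = Y := fun Y => by rw [← mul_assoc, w1, one_mul]
  have hX' : W * (X * Wᴴ) = X := by rw [← mul_assoc, hX, mul_assoc, w2, mul_one]
  have hD' : W * (D * (Dᴴ * Wᴴ)) = D * Dᴴ := by
    rw [← mul_assoc D, ← mul_assoc W, hD, mul_assoc, w2, mul_one]
  constructor
  · rw [fromBlocks_conjTranspose, fromBlocks_multiply]
    simp only [conjTranspose_mul, conjTranspose_neg, conjTranspose_conjTranspose]
    congr 1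
    · rw [hM]
    · rw [mul_neg, ← mul_assoc, ← mul_assoc, h1, add_neg_cancel]
    · rw [neg_mul, mul_assoc, mul_assoc, h1', add_neg_cancel]
    · rw [neg_mul_neg]
      have e1 : W * Dᴴ * (D * Wᴴ) = D * Dᴴ := by
        rw [← hD', mul_assoc, ← mul_assoc Dᴴ, h3, mul_assoc]
      have e2 : W * Mᴴ * (M * Wᴴ) = X := by
        rw [mul_assoc, ← mul_assoc Mᴴ, hM', hX']
      rw [e1, e2, add_comm]
  · rw [fromBlocks_conjTranspose, fromBlocks_multiply]
    simp only [conjTranspose_mul, conjTranspose_neg, conjTranspose_conjTranspose]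
    congr 1
    · rw [hM', mul_assoc, w1']
    · rw [mul_neg, mul_assoc, w1', h2', add_neg_cancel]
    · rw [neg_mul, mul_assoc, w1', h2, add_neg_cancel]
    · rw [neg_mul_neg, mul_assoc, w1', h3, hM, add_comm]
end alg

section
variable {n : ℕ} [NeZero n]

/-- skew reversal -/
def rv (f : ZMod n → ℤ) : ZMod n → ℤ := fun e => f (-1 - e)

lemma rv_rv (f : ZMod n → ℤ) : rv (rv f) = f := by
  funext e; simp [rv]

/-- shift matrix -/
def om (n : ℕ) [NeZero n] : Matrix (ZMod n) (ZMod n) ℚ := circ (Pi.single (-1) 1)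

lemma star_circ (f : ZMod n → ℤ) : star (circ f) = circ (fun x => f (-x)) := by
  ext i j; simp [circ, star_apply]

lemma circ_single_mul (k : ZMod n) (f : ZMod n → ℤ) (i j) :
    (circ (Pi.single k 1) * circ f) i j = f (i - k - j) := by
  rw [mul_apply, Fintype.sum_eq_single (i - k)]
  · simp [circ]
  · intro x hx
    have : i - x ≠ k := fun h => hx (by rw [← h]; ring)
    simp [circ, Pi.single_apply, this]

lemma circ_rv (f : ZMod n → ℤ) : circ (rv f) = om n * star (circ f) := by
  ext i j
  rw [om, star_circ, circ_single_mul]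
  simp only [circ, circulant_apply, rv]
  congr 2; ring

lemma om_star : om n * star (om n) = 1 := by
  ext i j
  rw [om, star_circ, circ_single_mul]
  simp only [one_apply, Pi.single_apply]
  by_cases h : i = j
  · subst h; simp
  · have : ¬ (-(i - -1 - j) = -1) := fun h' => h (by linear_combination -h')
    rw [if_neg this, if_neg h, Int.cast_zero]

lemma star_comm (f g : ZMod n → ℤ) : star (circ f) * circ g = circ g * star (circ f) := by
  rw [star_circ]; exact circ_comm _ _

lemma star_om : star (om n) * om n = 1 := by
  rw [om, star_comm]; exact om_star

/-- matrices of circulants -/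
def MC {ι : Type} (m : ι → ι → ZMod n → ℤ) : Matrix ι ι (Matrix (ZMod n) (ZMod n) ℚ) :=
  Matrix.of fun i j => circ (m i j)

variable {ι : Type} [Fintype ι] [DecidableEq ι]

lemma circ_zero : circ (0 : ZMod n → ℤ) = 0 := by ext i j; simp [circ]

/-- the doubled array -/
def dblm (m : ι → ι → ZMod n → ℤ) (a : ZMod n → ℤ) : (ι ⊕ ι) → (ι ⊕ ι) → ZMod n → ℤ
  | Sum.inl i, Sum.inl j => m i j
  | Sum.inl i, Sum.inr j => if i = j then a else 0
  | Sum.inr i, Sum.inl j => if i = j then rv a else 0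
  | Sum.inr i, Sum.inr j => - rv (m j i)

lemma MC_dblm (m : ι → ι → ZMod n → ℤ) (a : ZMod n → ℤ) :
    MC (dblm m a) = fromBlocks (MC m) (diagonal fun _ => circ a)
      ((diagonal fun _ => om n) * (diagonal fun _ => circ a)ᴴ)
      (-((diagonal fun _ => om n) * (MC m)ᴴ)) := by
  ext1 i j
  rcases i with i | i <;> rcases j with j | j
  · simp [MC, dblm]
  · simp only [MC, dblm, of_apply, fromBlocks_apply₁₂, diagonal_apply]
    split_ifs <;> simp [circ_zero]
  · simp only [MC, dblm, of_apply, fromBlocks_apply₂₁, diagonal_conjTranspose, diagonal_mul_diagonal,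
      diagonal_apply]
    split_ifs
    · rw [circ_rv]; rfl
    · exact circ_zero
  · simp only [MC, dblm, of_apply, fromBlocks_apply₂₂, Matrix.neg_apply, diagonal_mul,
      conjTranspose_apply, circ_neg, circ_rv]

lemma sum_ite_fun (i : ι) (a : ZMod n → ℤ) (e : ZMod n) :
    ∑ j, (|(if i = j then a else 0) e| + |(if i = j then a else 0) (-1 - e)|) = |a e| + |a (-1 - e)| := by
  rw [Fintype.sum_eq_single i]
  · simp
  · intro j hj; simp [Ne.symm hj]

lemma sum_ite_fun' (i : ι) (a : ZMod n → ℤ) (e : ZMod n) :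
    ∑ j, (|(if j = i then a else 0) e| + |(if j = i then a else 0) (-1 - e)|) = |a e| + |a (-1 - e)| := by
  rw [Fintype.sum_eq_single i]
  · simp
  · intro j hj; simp [hj]

theorem dbl (α : List (ZMod n → ℤ)) : ∃ (ι : Type) (_ : Fintype ι) (_ : DecidableEq ι)
    (m : ι → ι → ZMod n → ℤ), Fintype.card ι = 2 ^ α.length ∧
    (∀ i e, ∑ j, (|m i j e| + |m i j (-1 - e)|) = (α.map fun a => |a e| + |a (-1 - e)|).sum) ∧
    (∀ i e, ∑ j, (|m j i e| + |m j i (-1 - e)|) = (α.map fun a => |a e| + |a (-1 - e)|).sum) ∧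
    MC m * (MC m)ᴴ = diagonal (fun _ => (α.map fun a => circ a * star (circ a)).sum) ∧
    (MC m)ᴴ * MC m = diagonal (fun _ => (α.map fun a => circ a * star (circ a)).sum) := by
  induction α with
  | nil =>
    refine ⟨Unit, inferInstance, inferInstance, fun _ _ => 0, by simp, by simp, by simp, ?_, ?_⟩
    · have : MC (fun _ _ => 0 : Unit → Unit → ZMod n → ℤ) = 0 := by ext1 i j; exact circ_zero
      rw [this]; simp
    · have : MC (fun _ _ => 0 : Unit → Unit → ZMod n → ℤ) = 0 := by ext1 i j; exact circ_zero
      rw [this]; simp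
  | cons a α ih =>
    obtain ⟨ι, _, _, m, hc, hr, hcol, h1, h2⟩ := ih
    have key := dbl_alg (MC m) (diagonal fun _ => circ a) (diagonal fun _ => om n) _
      (by ext1 i j; simp only [diagonal_mul, mul_diagonal, MC, of_apply]; exact circ_comm _ _)
      (by ext1 i j
          simp only [diagonal_conjTranspose, diagonal_mul, mul_diagonal, MC, of_apply]
          exact star_comm _ _)
      (by simp only [diagonal_conjTranspose, diagonal_mul_diagonal]
          congr 1; funext _; exact star_comm _ _)
      (by simp only [diagonal_conjTranspose, diagonal_mul_diagonal]
          rw [← diagonal_one]; congr 1; funext _; exact star_om)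
      (by simp only [diagonal_conjTranspose, diagonal_mul_diagonal]
          rw [← diagonal_one]; congr 1; funext _; exact om_star)
      (by simp only [diagonal_mul_diagonal]
          congr 1; funext _
          refine (Commute.list_sum_right _ _ ?_)
          intro x hx
          obtain ⟨b, _, rfl⟩ := List.mem_map.1 hx
          refine Commute.mul_right (circ_comm _ _) ?_
          rw [star_circ]; exact circ_comm _ _)
      (by simp only [diagonal_conjTranspose, diagonal_mul_diagonal]
          congr 1; funext _
          refine Commute.mul_right (circ_comm _ _) ?_
          rw [Pi.star_apply, star_circ]; exact circ_comm _ _) h1 h2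
    rw [← MC_dblm] at key
    have e : fromBlocks ((diagonal fun _ : ι => (α.map fun a => circ a * star (circ a)).sum) +
        (diagonal fun _ => circ a) * (diagonal fun _ => circ a)ᴴ) 0 0
        ((diagonal fun _ : ι => (α.map fun a => circ a * star (circ a)).sum) +
        (diagonal fun _ => circ a) * (diagonal fun _ => circ a)ᴴ) =
        diagonal (fun _ : ι ⊕ ι => ((a :: α).map fun a => circ a * star (circ a)).sum) := by
      simp only [diagonal_conjTranspose, diagonal_mul_diagonal, diagonal_add, fromBlocks_diagonal]
      congr 1
      funext i
      rcases i with i | i <;> simp [add_comm]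
    refine ⟨ι ⊕ ι, inferInstance, inferInstance, dblm m a, ?_, ?_, ?_, key.1.trans e, key.2.trans e⟩
    · simp [hc, pow_succ]; ring
    · intro i e
      rcases i with i | i
      · simp only [Fintype.sum_sum_type, dblm, hr, sum_ite_fun, List.map_cons, List.sum_cons]; ring
      · simp only [Fintype.sum_sum_type, dblm, sum_ite_fun, List.map_cons, List.sum_cons]
        have := hcol i e
        simp only [Pi.neg_apply, abs_neg, rv, sub_sub_cancel, ← this]
        congr 1
        · ring
        · exact Finset.sum_congr rfl fun _ _ => add_comm _ _
    · intro i e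
      rcases i with i | i
      · simp only [Fintype.sum_sum_type, dblm, hcol, sum_ite_fun', List.map_cons, List.sum_cons, rv, sub_sub_cancel]
        ring
      · simp only [Fintype.sum_sum_type, dblm, sum_ite_fun', List.map_cons, List.sum_cons]
        have := hr i e
        simp only [Pi.neg_apply, abs_neg, rv, sub_sub_cancel, ← this]
        congr 1
        exact Finset.sum_congr rfl fun _ _ => add_comm _ _
end
end PH

set_option linter.unusedSectionVars false
set_option linter.unusedSimpArgs false
namespace PH
open Matrix
open scoped Kronecker

lemma pm_of_sum {κ : Type} [Fintype κ] [DecidableEq κ] (x : κ → ℤ) (y : κ → ℚ)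
    (hy : ∀ k, y k = 1 ∨ y k = -1) (hx : ∑ k, |x k| = 1) :
    ∑ k, (x k : ℚ) * y k = 1 ∨ ∑ k, (x k : ℚ) * y k = -1 := by
  have : ∃ j, x j ≠ 0 := by
    by_contra! h
    simp [h] at hx
  obtain ⟨j, hj⟩ := this
  have hj1 : 1 ≤ |x j| := Int.one_le_abs hj
  have hs := Finset.add_sum_erase Finset.univ (fun k => |x k|) (Finset.mem_univ j)
  have h0 : 0 ≤ ∑ k ∈ Finset.univ.erase j, |x k| := Finset.sum_nonneg fun _ _ => abs_nonneg _
  have h1 : ∑ k ∈ Finset.univ.erase j, |x k| = 0 := by omega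
  have h2 : |x j| = 1 := by omega
  have h3 := (Finset.sum_eq_zero_iff_of_nonneg (fun _ _ => abs_nonneg _)).1 h1
  rw [Fintype.sum_eq_single j]
  · rcases abs_eq (by norm_num : (0:ℤ) ≤ 1) |>.1 h2 with h | h <;> rcases hy j with h' | h' <;>
      simp [h, h']
  · intro k hk
    have := h3 k (Finset.mem_erase.2 ⟨hk, Finset.mem_univ _⟩)
    simp [abs_eq_zero.1 this]

section
variable {n : ℕ} [NeZero n] {ι : Type} [Fintype ι] [DecidableEq ι]

def finm (m : ι → ι → ZMod n → ℤ) : (ι ⊕ ι) → (ι ⊕ ι) → ZMod n → ℤ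
  | Sum.inl i, Sum.inl j => m i j
  | Sum.inl i, Sum.inr j => rv (m i j)
  | Sum.inr i, Sum.inl j => m i j
  | Sum.inr i, Sum.inr j => - rv (m i j)

lemma MC_finm (m : ι → ι → ZMod n → ℤ) :
    MC (finm m) = fromBlocks (MC m) (MC fun i j => rv (m i j)) (MC m) (-(MC fun i j => rv (m i j))) := by
  ext1 i j
  rcases i with i | i <;> rcases j with j | j <;> simp [MC, finm, circ_neg]

lemma finm_row (m : ι → ι → ZMod n → ℤ) (h : ∀ i e, ∑ j, (|m i j e| + |m i j (-1 - e)|) = 1) (i e) :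
    ∑ j, |finm m i j e| = 1 := by
  rcases i with i | i
  · rw [← h i e]; simp [Fintype.sum_sum_type, finm, rv, Finset.sum_add_distrib]
  · rw [← h i e]; simp [Fintype.sum_sum_type, finm, rv, Finset.sum_add_distrib]

lemma MC_rv_mul (m : ι → ι → ZMod n → ℤ) (i j) :
    ((MC fun i j => rv (m i j)) * (MC fun i j => rv (m i j))ᴴ) i j = (MC m * (MC m)ᴴ) j i := by
  simp only [mul_apply, MC, conjTranspose_apply, of_apply, circ_rv, star_mul, star_star]
  refine Finset.sum_congr rfl fun k _ => ?_
  rw [mul_assoc, ← mul_assoc (star (circ (m i k))), star_comm, ← mul_assoc]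
  have : om n * (circ (m j k) * star (circ (m i k))) = circ (m j k) * star (circ (m i k)) * om n := by
    refine Commute.mul_right (circ_comm _ _) ?_
    rw [star_circ]; exact circ_comm _ _
  rw [this, mul_assoc, om_star, mul_one]

lemma MC_finm_mul (m : ι → ι → ZMod n → ℤ) (c : ℚ)
    (h : MC m * (MC m)ᴴ = diagonal fun _ => (c • 1 : Matrix (ZMod n) (ZMod n) ℚ)) :
    MC (finm m) * (MC (finm m))ᴴ = diagonal fun _ => ((2 * c) • 1 : Matrix (ZMod n) (ZMod n) ℚ) := by
  have h' : (MC fun i j => rv (m i j)) * (MC fun i j => rv (m i j))ᴴ =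
      diagonal fun _ => (c • 1 : Matrix (ZMod n) (ZMod n) ℚ) := by
    ext1 i j
    rw [MC_rv_mul, h]
    simp only [diagonal_apply, eq_comm]
  rw [MC_finm, fromBlocks_conjTranspose, fromBlocks_multiply]
  simp only [conjTranspose_neg, mul_neg, neg_mul, neg_neg, h, h', add_neg_cancel, diagonal_add,
    fromBlocks_diagonal]
  congr 1; funext i
  rcases i with i | i <;> simp [← add_smul, two_mul]

theorem had_of_list (α : List (ZMod n → ℤ)) (c : ℕ) (hn : n = 2 * c)
    (hone : ∀ e, (α.map fun a => |a e| + |a (-1 - e)|).sum = 1)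
    (hsum : (α.map fun a => circ a * star (circ a)).sum = (c : ℚ) • 1) :
    IsHad (2 ^ (α.length + 1) * n) := by
  obtain ⟨ι, _, _, m, hc, hr, -, h1, -⟩ := dbl α
  rw [hsum] at h1
  simp only [hone] at hr
  have h2 := MC_finm_mul m c h1
  have h3 := finm_row m hr
  have hcard : Fintype.card (ι ⊕ ι) = 2 ^ (α.length + 1) := by simp [hc, pow_succ]; ring
  obtain ⟨H0, H0pm, H0mul⟩ := isHad_two_pow (α.length + 1)
  let e := Fintype.equivFinOfCardEq hcard
  let H : Matrix (ι ⊕ ι) (ι ⊕ ι) ℚ := H0.submatrix e e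
  have Hpm : IsPM H := fun i j => H0pm _ _
  have Hmul : H * Hᵀ = ((2 ^ (α.length + 1) : ℕ) : ℚ) • 1 := by
    simp only [H]
    rw [transpose_submatrix, submatrix_mul_equiv, H0mul, submatrix_smul]
    simp
  let W : Matrix ((ι ⊕ ι) × ZMod n) ((ι ⊕ ι) × ZMod n) ℚ :=
    compRingEquiv (ι ⊕ ι) (ZMod n) ℚ (MC (finm m))
  have hW : W * Wᵀ = (n : ℚ) • 1 := by
    have : Wᵀ = compRingEquiv (ι ⊕ ι) (ZMod n) ℚ ((MC (finm m))ᴴ) := by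
      ext ⟨i, x⟩ ⟨j, y⟩; rfl
    rw [this, ← map_mul, h2]
    ext ⟨i, x⟩ ⟨j, y⟩
    simp only [compRingEquiv_apply, comp_apply, diagonal_apply, Matrix.smul_apply, one_apply, hn]
    by_cases hij : i = j
    · subst hij; simp [one_apply]
    · simp [hij]
  refine IsHad.of_fintype _ (W * (H ⊗ₖ (1 : Matrix (ZMod n) (ZMod n) ℚ))) ?_ ?_ ?_
  · rw [Fintype.card_prod, hcard, ZMod.card]
  · rintro ⟨i, x⟩ ⟨j, y⟩
    have : (W * (H ⊗ₖ (1 : Matrix (ZMod n) (ZMod n) ℚ))) (i, x) (j, y) =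
        ∑ k, (finm m i k (x - y) : ℚ) * H k j := by
      rw [mul_apply, Fintype.sum_prod_type]
      refine Finset.sum_congr rfl fun k _ => ?_
      rw [Fintype.sum_eq_single y]
      · have : W (i, x) (k, y) = (finm m i k (x - y) : ℚ) := rfl
        rw [this]; simp
      · intro z hz; simp [one_apply, hz]
    rw [this]
    exact pm_of_sum _ _ (fun k => Hpm k j) (h3 i (x - y))
  · rw [transpose_mul, kron_tr, transpose_one, mul_assoc, ← mul_assoc (H ⊗ₖ _), ← mul_kronecker_mul,
      Hmul, one_mul, smul_kronecker, one_kronecker_one, smul_mul_assoc, one_mul, mul_smul_comm, hW,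
      smul_smul]
    push_cast; rfl
end
end PH

set_option linter.unusedSectionVars false
set_option linter.unusedSimpArgs false
namespace PH
open Matrix

/-- evaluation of a finite sequence as a polynomial -/
def ev {K : Type} [Ring K] (g : ℕ) (A : ℕ → ℤ) (x : K) : K :=
  ∑ i ∈ Finset.range g, (A i : K) * x ^ i

/-- Golay pairs -/
def Gol (g : ℕ) (A B : ℕ → ℤ) : Prop :=
  (∀ i < g, A i = 1 ∨ A i = -1) ∧ (∀ i < g, B i = 1 ∨ B i = -1) ∧
  ∀ (K : Type) [CommRing K] (x y : K), x * y = 1 →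
    ev g A x * ev g A y + ev g B x * ev g B y = 2 * (g : K)

def GolLen (g : ℕ) : Prop := ∃ A B, Gol g A B

lemma ev_mul {K : Type} [CommRing K] (g b : ℕ) (hb : 0 < b) (A U : ℕ → ℤ) (x : K) :
    ev (g * b) (fun i => A (i / b) * U (i % b)) x = ev g A (x ^ b) * ev b U x := by
  induction g with
  | zero => simp [ev]
  | succ g ih =>
    unfold ev at *
    rw [Nat.succ_mul, Finset.sum_range_add, ih, Finset.sum_range_succ, add_mul]
    congr 1
    rw [Finset.mul_sum]
    refine Finset.sum_congr rfl fun s hs => ?_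
    have hs' := Finset.mem_range.1 hs
    have h1 : (g * b + s) / b = g := by
      rw [mul_comm, Nat.mul_add_div hb, Nat.div_eq_of_lt hs', add_zero]
    have h2 : (g * b + s) % b = s := by
      rw [mul_comm, Nat.mul_add_mod, Nat.mod_eq_of_lt hs']
    simp only [h1, h2]
    rw [pow_add, mul_comm g b, pow_mul]
    push_cast; ring

lemma ev_rev {K : Type} [CommRing K] (b : ℕ) (U : ℕ → ℤ) (x y : K) (h : x * y = 1) :
    ev b (fun s => U (b - 1 - s)) x = x ^ (b - 1) * ev b U y := by
  unfold ev
  rw [← Finset.sum_range_reflect, Finset.mul_sum]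
  refine Finset.sum_congr rfl fun s hs => ?_
  have hs' := Finset.mem_range.1 hs
  have e : b - 1 - (b - 1 - s) = s := by omega
  have e2 : b - 1 = (b - 1 - s) + s := by omega
  have e3 : x ^ (b - 1) * y ^ s = x ^ (b - 1 - s) := by
    conv_lhs => rw [e2]
    rw [pow_add, mul_assoc, ← mul_pow, h, one_pow, mul_one]
  simp only [e]
  rw [← e3]; ring

lemma ev_add {K : Type} [Ring K] (g : ℕ) (A B : ℕ → ℤ) (x : K) :
    ev g (fun i => A i + B i) x = ev g A x + ev g B x := by
  simp [ev, add_mul, Finset.sum_add_distrib]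
lemma ev_sub {K : Type} [Ring K] (g : ℕ) (A B : ℕ → ℤ) (x : K) :
    ev g (fun i => A i - B i) x = ev g A x - ev g B x := by
  simp [ev, sub_mul, Finset.sum_sub_distrib]

lemma GolLen.mul_of {g b : ℕ} (hb : 0 < b) (U W : ℕ → ℤ)
    (hUW : ∀ s < b, ((U s = 1 ∨ U s = -1) ∧ W s = 0) ∨ (U s = 0 ∧ (W s = 1 ∨ W s = -1)))
    (hs : ∀ (K : Type) [CommRing K] (x y : K), x * y = 1 →
      ev b U x * ev b U y + ev b W x * ev b W y = (b : K)) (hg : GolLen g) : GolLen (g * b) := by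
  obtain ⟨A, B, hA, hB, h⟩ := hg
  refine ⟨fun i => A (i / b) * U (i % b) + B (i / b) * W (i % b),
    fun i => A (i / b) * W (b - 1 - i % b) - B (i / b) * U (b - 1 - i % b), ?_, ?_, ?_⟩
  · intro i hi
    have h1 : i / b < g := Nat.div_lt_of_lt_mul (by rwa [mul_comm])
    have h2 : i % b < b := Nat.mod_lt _ hb
    rcases hUW _ h2 with ⟨hu, hw⟩ | ⟨hu, hw⟩
    · simp only [hw]
      rcases hA _ h1 with a | a <;> rcases hu with u | u <;> simp [a, u]
    · simp only [hu]
      rcases hB _ h1 with a | a <;> rcases hw with u | u <;> simp [a, u]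
  · intro i hi
    have h1 : i / b < g := Nat.div_lt_of_lt_mul (by rwa [mul_comm])
    have h2 : b - 1 - i % b < b := by omega
    rcases hUW _ h2 with ⟨hu, hw⟩ | ⟨hu, hw⟩
    · simp only [hw]
      rcases hB _ h1 with a | a <;> rcases hu with u | u <;> simp [a, u]
    · simp only [hu]
      rcases hA _ h1 with a | a <;> rcases hw with u | u <;> simp [a, u]
  · intro K _ x y hxy
    have hyx : y * x = 1 := by rw [mul_comm]; exact hxy
    have hb' : x ^ b * y ^ b = 1 := by rw [← mul_pow, hxy, one_pow]
    have hb1 : x ^ (b - 1) * y ^ (b - 1) = 1 := by rw [← mul_pow, hxy, one_pow]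
    have e1 := h K (x ^ b) (y ^ b) hb'
    have e2 := hs K x y hxy
    rw [ev_add, ev_add, ev_sub, ev_sub]
    simp only [ev_mul g b hb A U, ev_mul g b hb B W,
      ev_mul g b hb A (fun s => W (b - 1 - s)), ev_mul g b hb B (fun s => U (b - 1 - s)),
      ev_rev b W x y hxy, ev_rev b W y x hyx, ev_rev b U x y hxy, ev_rev b U y x hyx]
    push_cast
    generalize ev g A (x ^ b) = a at *
    generalize ev g A (y ^ b) = a' at *
    generalize ev g B (x ^ b) = c at *
    generalize ev g B (y ^ b) = c' at *
    generalize ev b U x = u at *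
    generalize ev b U y = u' at *
    generalize ev b W x = w at *
    generalize ev b W y = w' at *
    generalize x ^ (b - 1) = p at *
    generalize y ^ (b - 1) = q at *
    linear_combination (a * w' - c * u') * (a' * w - c' * u) * hb1 + (u * u' + w * w') * e1
      + 2 * (g : K) * e2

lemma golLen_one : GolLen 1 := by
  refine ⟨fun _ => 1, fun _ => 1, by simp, by simp, ?_⟩
  intro K _ x y _
  simp [ev]; norm_num

lemma GolLen.two {g : ℕ} (hg : GolLen g) : GolLen (g * 2) := by
  refine hg.mul_of (by norm_num) (fun s => if s = 0 then 1 else 0) (fun s => if s = 0 then 0 else 1) ?_ ?_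
  · intro s _; by_cases h : s = 0 <;> simp [h]
  · intro K _ x y h
    simp [ev, Finset.sum_range_succ, h]; norm_num

/-- first half-sum of the Golay pair of length ten -/
def U10 : ℕ → ℤ
  | 0 => 1 | 1 => 1 | 2 => -1 | 3 => 1 | 5 => 1 | _ => 0
/-- half-difference of the Golay pair of length ten -/
def W10 : ℕ → ℤ
  | 4 => -1 | 6 => -1 | 7 => -1 | 8 => 1 | 9 => 1 | _ => 0

lemma GolLen.ten {g : ℕ} (hg : GolLen g) : GolLen (g * 10) := by
  refine hg.mul_of (by norm_num) U10 W10 (by decide) ?_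
  intro K _ x y h
  simp only [ev, Finset.sum_range_succ, Finset.sum_range_zero, U10, W10]
  push_cast
  linear_combination ((9)*x^0*y^0 + (-1)*x^0*y^1 + (1)*x^0*y^2 + (-1)*x^1*y^0 + (8)*x^1*y^1 + (-1)*x^1*y^4 +
      (-1)*x^0*y^3 + (1)*x^2*y^0 + (7)*x^2*y^2 + (-1)*x^4*y^1 + (-1)*x^3*y^0 + (5)*x^4*y^4 +
      (6)*x^3*y^3 + (-1)*x^3*y^5 + (-1)*x^3*y^7 + (-1)*x^2*y^6 + (-1)*x^1*y^5 + (-1)*x^3*y^8 +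
      (-1)*x^2*y^7 + (-1)*x^1*y^6 + (-1)*x^0*y^5 + (-1)*x^5*y^3 + (4)*x^5*y^5 + (1)*x^5*y^6 +
      (1)*x^4*y^5 + (1)*x^3*y^4 + (1)*x^2*y^3 + (-2)*x^5*y^7 + (-2)*x^4*y^6 + (-1)*x^5*y^8 +
      (-1)*x^4*y^7 + (1)*x^6*y^5 + (1)*x^5*y^4 + (1)*x^4*y^3 + (1)*x^3*y^2 + (3)*x^6*y^6 +
      (-1)*x^6*y^8 + (-1)*x^7*y^3 + (-1)*x^6*y^2 + (-1)*x^5*y^1 + (-2)*x^7*y^5 + (-2)*x^6*y^4 +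
      (2)*x^7*y^7 + (1)*x^7*y^8 + (-1)*x^8*y^3 + (-1)*x^7*y^2 + (-1)*x^6*y^1 + (-1)*x^5*y^0 +
      (-1)*x^8*y^5 + (-1)*x^7*y^4 + (-1)*x^8*y^6 + (1)*x^8*y^7 + (1)*x^8*y^8) * h

lemma golLen_two_ten (a b : ℕ) : GolLen (2 ^ a * 10 ^ b) := by
  induction b with
  | zero =>
    induction a with
    | zero => simpa using golLen_one
    | succ a ih => simpa [pow_succ] using ih.two
  | succ b ih => simpa [pow_succ, mul_assoc] using ih.ten

lemma Gol.ring {g : ℕ} {A B : ℕ → ℤ} (h : Gol g A B) {R : Type} [Ring R] (x y : R) (hxy : x * y = 1)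
    (hyx : y * x = 1) : ev g A x * ev g A y + ev g B x * ev g B y = 2 * (g : R) := by
  let s : Set R := {x, y}
  have hcomm : ∀ a ∈ s, ∀ b ∈ s, a * b = b * a := by
    rintro a (rfl | rfl) b (rfl | rfl) <;> simp [hxy, hyx]
  letI := Subring.closureCommRingOfComm hcomm
  let x' : Subring.closure s := ⟨x, Subring.subset_closure (by simp [s])⟩
  let y' : Subring.closure s := ⟨y, Subring.subset_closure (by simp [s])⟩
  have key := h.2.2 (Subring.closure s) x' y' (Subtype.ext hxy)
  have e : ∀ (A : ℕ → ℤ) (z : Subring.closure s), ((ev g A z : Subring.closure s) : R) = ev g A (z : R) := by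
    intro A z
    have := map_sum (Subring.closure s).subtype (fun i => (A i : Subring.closure s) * z ^ i) (Finset.range g)
    simpa [ev] using this
  have k2 := congrArg (fun z : Subring.closure s => (z : R)) key
  have k3 : ((ev g A x' : Subring.closure s) : R) * (ev g A y' : Subring.closure s) +
    (ev g B x' : Subring.closure s) * (ev g B y' : Subring.closure s) = 2 * (g : R) := by
    exact k2.trans (by push_cast; rfl)
  rw [e, e, e, e] at k3
  exact k3
end PH

set_option linter.unusedSectionVars false
set_option linter.unusedSimpArgs false
namespace PH
open Matrix

section
variable {n : ℕ} [NeZero n]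

/-- placing a sequence of length `g` at offset `o` -/
def pl (n o g : ℕ) (A : ℕ → ℤ) : ZMod n → ℤ := fun e =>
  if o ≤ e.val ∧ e.val < o + g then A (e.val - o) else 0

lemma abs_pl (o g : ℕ) (A : ℕ → ℤ) (hA : ∀ i < g, A i = 1 ∨ A i = -1) (e : ZMod n) :
    |pl n o g A e| = if o ≤ e.val ∧ e.val < o + g then 1 else 0 := by
  unfold pl
  split_ifs with h
  · rcases hA (e.val - o) (by omega) with h | h <;> simp [h]
  · simp

lemma circ_single_pow (k : ℕ) :
    (circ (Pi.single (1 : ZMod n) 1)) ^ k = circ (Pi.single ((k : ℕ) : ZMod n) 1) := by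
  induction k with
  | zero =>
    ext i j
    by_cases h : i = j
    · subst h; simp [circ]
    · have : i - j ≠ 0 := sub_ne_zero.2 h
      simp [circ, h, Pi.single_apply, this]
  | succ k ih =>
    rw [pow_succ', ih]
    ext i j
    rw [circ_single_mul]
    simp only [circ, circulant_apply, Pi.single_apply]
    congr 2
    apply propext
    constructor
    · intro h; push_cast; linear_combination h
    · intro h; push_cast at h; linear_combination h

lemma circ_pl (o g : ℕ) (A : ℕ → ℤ) (h : o + g ≤ n) :
    circ (pl n o g A) = (circ (Pi.single (1 : ZMod n) 1)) ^ o * ev g A (circ (Pi.single (1 : ZMod n) 1)) := by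
  unfold ev
  rw [Finset.mul_sum]
  have e1 : ∀ i, (circ (Pi.single (1 : ZMod n) 1)) ^ o * ((A i : Matrix (ZMod n) (ZMod n) ℚ)
      * (circ (Pi.single (1 : ZMod n) 1)) ^ i) = (A i : ℚ) • circ (Pi.single ((o + i : ℕ) : ZMod n) 1) := by
    intro i
    rw [← circ_single_pow, pow_add, ← mul_assoc, ← (Int.cast_commute (A i) _).eq, mul_assoc, ← zsmul_eq_mul]
    ext i j; simp
  simp only [e1]
  ext a b
  rw [Matrix.sum_apply]
  simp only [Matrix.smul_apply, circ, circulant_apply, pl]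
  generalize a - b = z
  have e2 : ∀ i, i < g → (z = ((o + i : ℕ) : ZMod n) ↔ z.val = o + i) := by
    intro i hi
    constructor
    · intro h; rw [h, ZMod.val_natCast, Nat.mod_eq_of_lt (by omega)]
    · intro h; rw [← h, ZMod.natCast_zmod_val]
  split_ifs with h1
  · rw [Finset.sum_eq_single (z.val - o)]
    · have := (e2 (z.val - o) (by omega)).2 (by omega)
      rw [← this]; simp
    · intro i hi hne
      have : z ≠ ((o + i : ℕ) : ZMod n) := fun h => hne (by
        have := (e2 i (Finset.mem_range.1 hi)).1 h; omega)
      rw [Pi.single_apply, if_neg this]; simp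
    · intro h'; exact absurd (Finset.mem_range.2 (by omega)) h'
  · rw [Finset.sum_eq_zero]
    · simp
    · intro i hi
      have : z ≠ ((o + i : ℕ) : ZMod n) := fun h => h1 (by
        have := (e2 i (Finset.mem_range.1 hi)).1 h
        have := Finset.mem_range.1 hi; omega)
      rw [Pi.single_apply, if_neg this]; simp

lemma star_ev (g : ℕ) (A : ℕ → ℤ) (x : Matrix (ZMod n) (ZMod n) ℚ) : star (ev g A x) = ev g A (star x) := by
  unfold ev
  rw [star_sum]
  refine Finset.sum_congr rfl fun i _ => ?_
  rw [star_mul, star_intCast, star_pow, (Int.cast_commute (A i) _).eq]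

lemma S_star : circ (Pi.single (1 : ZMod n) 1) * star (circ (Pi.single (1 : ZMod n) 1)) = 1 := by
  ext i j
  rw [star_circ, circ_single_mul]
  simp only [one_apply, Pi.single_apply]
  by_cases h : i = j
  · subst h; simp
  · have : ¬ (-(i - 1 - j) = 1) := fun h' => h (by linear_combination -h')
    rw [if_neg this, if_neg h, Int.cast_zero]

lemma circ_pl_pair {g : ℕ} {A B : ℕ → ℤ} (h : Gol g A B) (o : ℕ) (ho : o + 2 * g ≤ n) :
    circ (pl n o g A) * star (circ (pl n o g A)) + circ (pl n (o + g) g B) * star (circ (pl n (o + g) g B))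
      = (2 * g : ℚ) • 1 := by
  rw [circ_pl o g A (by omega), circ_pl (o + g) g B (by omega)]
  have h1 := @S_star n _
  have h2 : star (circ (Pi.single (1 : ZMod n) 1)) * circ (Pi.single (1 : ZMod n) 1) = 1 := by
    rw [star_comm]; exact h1
  generalize circ (Pi.single (1 : ZMod n) 1) = S at *
  have key := h.ring S (star S) h1 h2
  have pw : ∀ k, S ^ k * star S ^ k = 1 := by
    intro k
    rw [← Commute.mul_pow (h1.trans h2.symm), h1, one_pow]
  have cm : ∀ k (A : ℕ → ℤ), S ^ k * ev g A S = ev g A S * S ^ k := by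
    intro k A
    unfold ev
    rw [Finset.mul_sum, Finset.sum_mul]
    refine Finset.sum_congr rfl fun i _ => ?_
    rw [← mul_assoc, ← (Int.cast_commute (A i) _).eq, mul_assoc, mul_assoc, ← pow_add, ← pow_add, add_comm]
  have one : ∀ k (A : ℕ → ℤ), S ^ k * ev g A S * star (S ^ k * ev g A S) = ev g A S * ev g A (star S) := by
    intro k A
    rw [cm k A, star_mul, star_ev, star_pow, mul_assoc, ← mul_assoc (S ^ k), pw, one_mul]
  rw [one, one, key]
  rw [← Algebra.algebraMap_eq_smul_one, map_mul, map_natCast, map_ofNat]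

lemma build (L : List ℕ) : (∀ g ∈ L, GolLen g) → ∀ o, o + 2 * L.sum ≤ n →
    ∃ α : List (ZMod n → ℤ), α.length = 2 * L.length ∧
    (∀ e : ZMod n, (α.map fun a => |a e|).sum = if o ≤ e.val ∧ e.val < o + 2 * L.sum then 1 else 0) ∧
    (α.map fun a => circ a * star (circ a)).sum = ((2 * L.sum : ℕ) : ℚ) • 1 := by
  induction L with
  | nil =>
    intro _ o _
    refine ⟨[], by simp, ?_, by simp⟩
    intro e
    rw [if_neg (by simp)]; simp
  | cons g L ih =>
    intro hL o ho
    obtain ⟨A, B, h⟩ := hL g (by simp)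
    simp only [List.sum_cons] at ho
    obtain ⟨α, h1, h2, h3⟩ := ih (fun g hg => hL g (by simp [hg])) (o + 2 * g) (by omega)
    refine ⟨pl n o g A :: pl n (o + g) g B :: α, by simp [h1]; ring, ?_, ?_⟩
    · intro e
      simp only [List.map_cons, List.sum_cons, h2, abs_pl _ _ _ h.1, abs_pl _ _ _ h.2.1]
      split_ifs <;> first | omega | rfl
    · simp only [List.map_cons, List.sum_cons, h3]
      rw [← add_assoc, circ_pl_pair h o (by omega), ← add_smul]
      push_cast; congr 1; ring
end

theorem had_golay (L : List ℕ) (hL : ∀ g ∈ L, GolLen g) (hpos : 0 < L.sum) :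
    IsHad (2 ^ (2 * L.length + 3) * L.sum) := by
  haveI : NeZero (4 * L.sum) := ⟨by omega⟩
  obtain ⟨α, h1, h2, h3⟩ := build (n := 4 * L.sum) L hL 0 (by omega)
  have key := had_of_list α (2 * L.sum) (by ring) ?_ h3
  · rw [h1] at key
    convert key using 1
    ring
  · intro e
    have e1 : (α.map fun a => |a e| + |a (-1 - e)|).sum =
        (α.map fun a => |a e|).sum + (α.map fun a => |a (-1 - e)|).sum := List.sum_map_add
    rw [e1, h2, h2]
    have hv : (-1 - e).val = 4 * L.sum - 1 - e.val := by
      have hlt := ZMod.val_lt e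
      have : (-1 - e) = ((4 * L.sum - 1 - e.val : ℕ) : ZMod (4 * L.sum)) := by
        have h5 : ((4 * L.sum - 1 - e.val + (1 + e.val) : ℕ) : ZMod (4 * L.sum)) = 0 := by
          rw [show 4 * L.sum - 1 - e.val + (1 + e.val) = 4 * L.sum by omega]
          exact ZMod.natCast_self _
        rw [Nat.cast_add, Nat.cast_add, ZMod.natCast_zmod_val, Nat.cast_one] at h5
        linear_combination -h5
      rw [this, ZMod.val_natCast, Nat.mod_eq_of_lt (by omega)]
    rw [hv]
    have hlt := ZMod.val_lt e
    split_ifs <;> first | omega | rfl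
end PH

namespace PH

lemma dense_aux (K p q a b : ℕ) (hK : 1 ≤ K) (hp : 2 ≤ p) (hq : 2 ≤ q) (hlt : q ^ b < p ^ a)
    (hle : K * p ^ a ≤ (K + 1) * q ^ b) :
    ∃ n0, ∀ n, n0 ≤ n → ∃ x y, p ^ x * q ^ y ≤ n ∧ K * n ≤ (K + 1) * (p ^ x * q ^ y) := by
  have hI : ∃ I : ℕ, q * (q ^ b) ^ I ≤ (p ^ a) ^ I := by
    have hqb : (0 : ℝ) < (q : ℝ) ^ b := by positivity
    have h1 : (1 : ℝ) < (p : ℝ) ^ a / (q : ℝ) ^ b := by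
      rw [one_lt_div hqb]; exact_mod_cast hlt
    obtain ⟨I, hI⟩ := pow_unbounded_of_one_lt (q : ℝ) h1
    refine ⟨I, ?_⟩
    rw [div_pow, lt_div_iff₀ (by positivity)] at hI
    exact_mod_cast hI.le
  obtain ⟨I, hI⟩ := hI
  refine ⟨q ^ (b * I) + 1, fun n hn => ?_⟩
  set y := Nat.log q n with hy
  have hn0 : n ≠ 0 := by omega
  have y1 : q ^ y ≤ n := Nat.pow_log_le_self q hn0
  have y2 : n < q ^ (y + 1) := Nat.lt_pow_succ_log_self (by omega) n
  have y3 : b * I ≤ y := Nat.le_log_of_pow_le (by omega) (by omega)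
  have hex : ∃ i, n < p ^ (a * i) * q ^ (y - b * i) := by
    refine ⟨I, lt_of_lt_of_le y2 ?_⟩
    calc q ^ (y + 1) = q * (q ^ b) ^ I * q ^ (y - b * I) := by
          rw [← pow_mul, mul_assoc, ← pow_add, Nat.add_sub_cancel' y3, pow_succ']
      _ ≤ (p ^ a) ^ I * q ^ (y - b * I) := Nat.mul_le_mul_right _ hI
      _ = _ := by rw [← pow_mul]
  have hmin := Nat.find_spec hex
  have hIle : Nat.find hex ≤ I := by
    refine Nat.find_le ?_
    refine lt_of_lt_of_le y2 ?_
    calc q ^ (y + 1) = q * (q ^ b) ^ I * q ^ (y - b * I) := by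
          rw [← pow_mul, mul_assoc, ← pow_add, Nat.add_sub_cancel' y3, pow_succ']
      _ ≤ (p ^ a) ^ I * q ^ (y - b * I) := Nat.mul_le_mul_right _ hI
      _ = _ := by rw [← pow_mul]
  obtain ⟨i, hi⟩ : ∃ i, Nat.find hex = i + 1 := by
    refine Nat.exists_eq_succ_of_ne_zero fun h0 => ?_
    rw [h0] at hmin
    simp at hmin; omega
  have hi' : ¬ n < p ^ (a * i) * q ^ (y - b * i) := Nat.find_min hex (by omega)
  rw [hi] at hmin hIle
  refine ⟨a * i, y - b * i, by omega, ?_⟩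
  have hb : b * (i + 1) ≤ y := (Nat.mul_le_mul_left b hIle).trans y3
  have e : y - b * i = b + (y - b * (i + 1)) := by rw [mul_add] at *; omega
  calc K * n ≤ K * (p ^ (a * (i + 1)) * q ^ (y - b * (i + 1))) := Nat.mul_le_mul_left _ hmin.le
    _ = (K * p ^ a) * (p ^ (a * i) * q ^ (y - b * (i + 1))) := by rw [mul_add, pow_add, mul_one]; ring
    _ ≤ ((K + 1) * q ^ b) * (p ^ (a * i) * q ^ (y - b * (i + 1))) := Nat.mul_le_mul_right _ hle
    _ = (K + 1) * (p ^ (a * i) * q ^ (y - b * i)) := by rw [e, pow_add]; ring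

lemma exp_bound (K : ℕ) (hK : 1 ≤ K) : Real.exp (Real.log 2 / (K + 1)) ≤ (K + 1) / K := by
  have hK' : (0 : ℝ) < K := by exact_mod_cast hK
  have h1 := Real.one_sub_le_exp_neg (Real.log 2 / (K + 1))
  rw [Real.exp_neg] at h1
  have h2 : (K : ℝ) / (K + 1) ≤ 1 - Real.log 2 / (K + 1) := by
    have : Real.log 2 ≤ 1 := by linarith [Real.log_two_lt_d9]
    rw [div_le_iff₀ (by positivity), sub_mul, div_mul_cancel₀ _ (by positivity)]
    linarith
  have h3 : (K : ℝ) / (K + 1) ≤ (Real.exp (Real.log 2 / (K + 1)))⁻¹ := h2.trans h1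
  rw [← inv_div (K : ℝ) (K + 1)]
  exact (le_inv_comm₀ (by positivity) (Real.exp_pos _)).1 h3

lemma approx (K : ℕ) (hK : 1 ≤ K) : ∃ a b : ℕ,
    (10 ^ b < 2 ^ a ∧ K * 2 ^ a ≤ (K + 1) * 10 ^ b) ∨ (2 ^ a < 10 ^ b ∧ K * 10 ^ b ≤ (K + 1) * 2 ^ a) := by
  have hK' : (0 : ℝ) < K := by exact_mod_cast hK
  obtain ⟨j, k, hk0, hkn, h⟩ := Real.exists_int_int_abs_mul_sub_le (Real.log 10 / Real.log 2) (n := K) hK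
  have hl2 : 0 < Real.log 2 := Real.log_pos (by norm_num)
  have hl10 : Real.log 2 ≤ Real.log 10 := Real.log_le_log (by norm_num) (by norm_num)
  lift k to ℕ using hk0.le
  have hk1 : (1 : ℝ) ≤ (k : ℝ) := by exact_mod_cast hk0
  have hj : 0 ≤ j := by
    have h1 : 1 ≤ Real.log 10 / Real.log 2 := (one_le_div hl2).2 hl10
    have h2 := (abs_le.1 h).2
    have h3 : (1 : ℝ) / ((K : ℝ) + 1) ≤ 1 := by
      rw [div_le_one (by positivity)]; linarith
    have h4 : (1 : ℝ) ≤ k * (Real.log 10 / Real.log 2) := one_le_mul_of_one_le_of_one_le hk1 h1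
    have h5 : (0 : ℝ) ≤ j := by
      have : ((k : ℤ) : ℝ) = k := by simp
      rw [this] at h2
      linarith
    exact_mod_cast h5
  lift j to ℕ using hj
  have hab : |k * Real.log 10 - j * Real.log 2| ≤ Real.log 2 / (K + 1) := by
    have e : (k : ℝ) * Real.log 10 - j * Real.log 2 = (((k : ℤ) : ℝ) * (Real.log 10 / Real.log 2) - ((j : ℤ) : ℝ)) * Real.log 2 := by
      push_cast; field_simp
    rw [e, abs_mul, abs_of_pos hl2]
    calc _ ≤ 1 / ((K : ℝ) + 1) * Real.log 2 := mul_le_mul_of_nonneg_right h hl2.le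
      _ = _ := by ring
  have hne : (10 : ℕ) ^ k ≠ 2 ^ j := by
    intro h
    have hd : 5 ∣ 2 ^ j := by
      rw [← h]; exact dvd_pow (by norm_num) (by omega)
    have := Nat.Prime.dvd_of_dvd_pow (by norm_num : Nat.Prime 5) hd
    omega
  have p1 : ∀ (x : ℝ) (m : ℕ), 0 < x → x ^ m = Real.exp (m * Real.log x) := by
    intro x m hx
    rw [mul_comm, Real.exp_mul, Real.exp_log hx, Real.rpow_natCast]
  have hb := exp_bound K hK
  refine ⟨j, k, ?_⟩
  have gen : ∀ u v : ℝ, u - v ≤ Real.log 2 / (K + 1) → K * Real.exp u ≤ (K + 1) * Real.exp v := by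
    intro u v huv
    have : Real.exp u ≤ (K + 1) / K * Real.exp v := by
      calc Real.exp u = Real.exp (u - v) * Real.exp v := by rw [← Real.exp_add]; ring_nf
        _ ≤ (K + 1) / K * Real.exp v := by
          refine mul_le_mul_of_nonneg_right ?_ (Real.exp_pos _).le
          exact (Real.exp_le_exp.2 huv).trans hb
    calc (K : ℝ) * Real.exp u ≤ K * ((K + 1) / K * Real.exp v) := mul_le_mul_of_nonneg_left this hK'.le
      _ = _ := by field_simp
  rcases lt_or_gt_of_ne hne with h | h
  · left
    refine ⟨h, ?_⟩
    have := gen (j * Real.log 2) (k * Real.log 10) (by linarith [(abs_le.1 hab).1])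
    rw [← p1 _ _ (by norm_num), ← p1 _ _ (by norm_num)] at this
    exact_mod_cast this
  · right
    refine ⟨h, ?_⟩
    have := gen (k * Real.log 10) (j * Real.log 2) (by linarith [(abs_le.1 hab).2])
    rw [← p1 _ _ (by norm_num), ← p1 _ _ (by norm_num)] at this
    exact_mod_cast this

lemma dense (K : ℕ) (hK : 1 ≤ K) :
    ∃ n0, ∀ n, n0 ≤ n → ∃ x y, 2 ^ x * 10 ^ y ≤ n ∧ K * n ≤ (K + 1) * (2 ^ x * 10 ^ y) := by
  obtain ⟨a, b, ⟨h1, h2⟩ | ⟨h1, h2⟩⟩ := approx K hK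
  · exact dense_aux K 2 10 a b hK (by norm_num) (by norm_num) h1 h2
  · obtain ⟨n0, h⟩ := dense_aux K 10 2 b a hK (by norm_num) (by norm_num) h1 h2
    refine ⟨n0, fun n hn => ?_⟩
    obtain ⟨x, y, h3, h4⟩ := h n hn
    exact ⟨y, x, by rwa [mul_comm], by rwa [mul_comm (2 ^ y)]⟩

lemma greedy (K : ℕ) (hK : 1 ≤ K) : ∃ c, 0 < c ∧ ∀ n, 1 ≤ n →
    ∃ L : List ℕ, (∀ g ∈ L, GolLen g) ∧ L.sum = n ∧ K ^ L.length ≤ c * n := by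
  obtain ⟨n0, h⟩ := dense K hK
  refine ⟨K ^ (n0 + 1), by positivity, fun n => ?_⟩
  induction n using Nat.strong_induction_on with
  | _ n ih =>
    intro hn
    by_cases hlt : n < n0
    · refine ⟨List.replicate n 1, ?_, by simp, ?_⟩
      · intro g hg; rw [List.eq_of_mem_replicate hg]; exact golLen_one
      · rw [List.length_replicate]
        calc K ^ n ≤ K ^ (n0 + 1) := Nat.pow_le_pow_right hK (by omega)
          _ ≤ _ := Nat.le_mul_of_pos_right _ hn
    · obtain ⟨x, y, h1, h2⟩ := h n (by omega)
      have hg := golLen_two_ten x y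
      have hpos : 0 < 2 ^ x * 10 ^ y := by positivity
      generalize 2 ^ x * 10 ^ y = g at *
      by_cases hz : n - g = 0
      · refine ⟨[g], by simpa using hg, by simp; omega, ?_⟩
        simp only [List.length_singleton, pow_one]
        calc K ≤ K ^ (n0 + 1) := Nat.le_self_pow (by omega) K
          _ ≤ _ := Nat.le_mul_of_pos_right _ hn
      · obtain ⟨L, hL1, hL2, hL3⟩ := ih (n - g) (by omega) (by omega)
        refine ⟨g :: L, by simpa using ⟨hg, hL1⟩, by simp; omega, ?_⟩
        have h5 : K * (n - g) ≤ n := by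
          have : K * (n - g) + K * g = K * n := by rw [← mul_add]; congr 1; omega
          have : (K + 1) * g = K * g + g := by ring
          omega
        rw [List.length_cons, pow_succ]
        calc K ^ L.length * K ≤ K ^ (n0 + 1) * (n - g) * K := Nat.mul_le_mul_right _ hL3
          _ = K ^ (n0 + 1) * (K * (n - g)) := by ring
          _ ≤ _ := Nat.mul_le_mul_left _ h5

theorem had_dense : ∃ c : ℕ, 0 < c ∧ ∀ n, 1 ≤ n → ∀ j, c * n ≤ 2 ^ (20 * j) → IsHad (2 ^ j * n) := by
  obtain ⟨c, hc, h⟩ := greedy (4 ^ 20) (by norm_num)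
  refine ⟨8 ^ 20 * c, by positivity, fun n hn j hj => ?_⟩
  obtain ⟨L, h1, h2, h3⟩ := h n hn
  have key := had_golay L h1 (by omega)
  rw [h2] at key
  have : 2 * L.length + 3 ≤ j := by
    have e : 2 ^ (20 * (2 * L.length + 3)) ≤ 2 ^ (20 * j) := by
      calc 2 ^ (20 * (2 * L.length + 3)) = 8 ^ 20 * (4 ^ 20) ^ L.length := by
            rw [show (8 : ℕ) = 2 ^ 3 by norm_num, show (4 : ℕ) = 2 ^ 2 by norm_num]
            simp only [← pow_mul, ← pow_add]
            congr 1; ring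
        _ ≤ 8 ^ 20 * (c * n) := Nat.mul_le_mul_left _ h3
        _ = 8 ^ 20 * c * n := by ring
        _ ≤ _ := hj
    have := (Nat.pow_le_pow_iff_right (by norm_num : 1 < 2)).1 e
    omega
  have e2 : 2 ^ j * n = 2 ^ (j - (2 * L.length + 3)) * (2 ^ (2 * L.length + 3) * n) := by
    rw [← mul_assoc, ← pow_add]; congr 2; omega
  rw [e2]
  exact (isHad_two_pow _).mul key
end PH

namespace PH

lemma root_step (T t m q : ℤ) (ht : t % 2 = 1) (hm : m % 2 = 1) (hq : 4 ∣ q)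
    (h : 4 * q ∣ T - t * m ^ 4) : 8 * q ∣ T - t * m ^ 4 ∨ 8 * q ∣ T - t * (m + q) ^ 4 := by
  obtain ⟨s, hs⟩ := h
  obtain ⟨r, hr⟩ := hq
  rcases Int.even_or_odd s with ⟨u, hu⟩ | hs1
  · left; exact ⟨u, by rw [hs, hu]; ring⟩
  · right
    have hodd : Odd (t * m ^ 3) := (Int.odd_iff.2 ht).mul ((Int.odd_iff.2 hm).pow)
    obtain ⟨u, hu⟩ := hs1.sub_odd hodd
    refine ⟨u - t * (3 * r * m ^ 2 + 8 * r ^ 2 * m + 8 * r ^ 3), ?_⟩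
    have e : T - t * (m + q) ^ 4 = 4 * q * (s - t * m ^ 3) - t * (6 * q ^ 2 * m ^ 2 + 4 * q ^ 3 * m + q ^ 4) := by
      linear_combination hs
    rw [e, hu, hr]; ring

lemma root_exists (T t : ℕ) (ht : t % 2 = 1) (h16 : T % 16 = t % 16) (i : ℕ) :
    ∃ m : ℕ, m % 2 = 1 ∧ ((2 : ℤ) ^ (i + 4)) ∣ (T : ℤ) - t * (m : ℤ) ^ 4 := by
  induction i with
  | zero => exact ⟨1, rfl, by norm_num; omega⟩
  | succ i ih =>
    obtain ⟨m, hm, h⟩ := ih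
    have hd : (4 : ℤ) ∣ 2 ^ (i + 2) := ⟨2 ^ i, by ring⟩
    have h' : 4 * (2 : ℤ) ^ (i + 2) ∣ (T : ℤ) - t * (m : ℤ) ^ 4 := by
      convert h using 1; ring
    have e : (2 : ℤ) ^ (i + 1 + 4) = 8 * 2 ^ (i + 2) := by ring
    rw [e]
    rcases root_step T t m (2 ^ (i + 2)) (by omega) (by omega) hd h' with h | h
    · exact ⟨m, hm, h⟩
    · refine ⟨m + 2 ^ (i + 2), ?_, by push_cast; exact h⟩
      have : 2 ^ (i + 2) % 2 = 0 := by rw [pow_succ]; omega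
      omega

lemma root_exists' (T j : ℕ) (hT : T % 2 = 1) (hj : 4 ≤ j) :
    ∃ t m : ℕ, t < 16 ∧ t % 2 = 1 ∧ m % 2 = 1 ∧ m < 2 ^ j ∧ ((2 : ℤ) ^ j) ∣ (T : ℤ) - t * (m : ℤ) ^ 4 := by
  obtain ⟨m, hm, h⟩ := root_exists T (T % 16) (by omega) (by omega) (j - 4)
  rw [show j - 4 + 4 = j by omega] at h
  refine ⟨T % 16, m % 2 ^ j, Nat.mod_lt _ (by norm_num), by omega, ?_, Nat.mod_lt _ (by positivity), ?_⟩
  · have : 2 ∣ 2 ^ j := dvd_pow_self 2 (by omega)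
    rw [Nat.mod_mod_of_dvd _ this]; exact hm
  · have e : ((m % 2 ^ j : ℕ) : ℤ) ≡ m [ZMOD 2 ^ j] := by
      push_cast; exact Int.mod_modEq _ _
    have e2 := (e.pow 4).mul_left ((T % 16 : ℕ) : ℤ)
    have e3 : ((T : ℤ)) ≡ ((T % 16 : ℕ) : ℤ) * (m : ℤ) ^ 4 [ZMOD 2 ^ j] := (Int.modEq_iff_dvd.2 h).symm
    exact Int.modEq_iff_dvd.1 (e2.trans e3.symm)

/-- a matrix of the wanted kind exists -/
def PHM (R N : ℕ) : Prop := ∃ H : Matrix (Fin R) (Fin N) ℤ,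
          (∀ i j, H i j = 1 ∨ H i j = -1) ∧
          H * H.transpose = (N : ℤ) • (1 : Matrix (Fin R) (Fin R) ℤ)

lemma phm_one (N : ℕ) : PHM 1 N := by
  refine ⟨Matrix.of fun _ _ => 1, by simp, ?_⟩
  ext i j
  have : i = j := Subsingleton.elim _ _
  subst this
  rw [Matrix.mul_apply]
  simp [Matrix.transpose_apply]

lemma findk (t J m0 T : ℕ) (ht : 0 < t) (hJ : 0 < J) (h : 2 * t * (m0 + J) ^ 4 ≤ T) :
    ∃ k, 1 ≤ k ∧ 2 * t * (m0 + J * k) ^ 4 ≤ T ∧ T < 2 * t * (m0 + J * k + J) ^ 4 := by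
  have hex : ∃ k, T < 2 * t * (m0 + J * k) ^ 4 := by
    refine ⟨T + 1, ?_⟩
    calc T < m0 + J * (T + 1) := by nlinarith
      _ ≤ (m0 + J * (T + 1)) ^ 4 := Nat.le_self_pow (by norm_num) _
      _ ≤ _ := Nat.le_mul_of_pos_left _ (by omega)
  have h1 := Nat.find_spec hex
  have h2 : 2 ≤ Nat.find hex := by
    by_contra! hlt
    have h3 : m0 + J * Nat.find hex ≤ m0 + J := by nlinarith
    have h4 := Nat.mul_le_mul_left (2 * t) (Nat.pow_le_pow_left h3 4)
    omega
  refine ⟨Nat.find hex - 1, by omega, ?_, ?_⟩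
  · exact not_lt.1 (Nat.find_min hex (by omega))
  · have e : m0 + J * (Nat.find hex - 1) + J = m0 + J * Nat.find hex := by
      rw [Nat.mul_sub, mul_one]
      have : J ≤ J * Nat.find hex := Nat.le_mul_of_pos_right _ (by omega)
      omega
    rw [e]; exact h1

theorem core : ∃ A : ℕ, ∀ N : ℕ, 0 < N → 4 ∣ N → ∃ R D : ℕ, 0 < R ∧ N ≤ 2 * R + 2 * D ∧
    D ^ 16 ≤ A * N ^ 13 ∧ PHM R N := by
  obtain ⟨c, hc, hd⟩ := had_dense
  refine ⟨(1920 ^ 4 + (128 ^ 4 * 15) ^ 4) * (2 ^ 100 * c), fun N hN h4 => ?_⟩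
  set B := 2 ^ 100 * c with hB
  obtain ⟨j, hj4, hj1, hj2⟩ : ∃ j, 4 ≤ j ∧ c * N ≤ 2 ^ (20 * j) ∧ (2 ^ j) ^ 20 ≤ B * N := by
    refine ⟨Nat.clog (2 ^ 20) (c * N) + 4, by omega, ?_, ?_⟩
    · calc c * N ≤ (2 ^ 20) ^ Nat.clog (2 ^ 20) (c * N) := Nat.le_pow_clog (by norm_num) _
        _ = 2 ^ (20 * Nat.clog (2 ^ 20) (c * N)) := by rw [← pow_mul]
        _ ≤ _ := Nat.pow_le_pow_right (by norm_num) (by omega)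
    · have hcN : 1 ≤ c * N := Nat.mul_pos hc hN
      rcases Nat.lt_or_ge 1 (c * N) with h | h
      · have h1 := Nat.pow_pred_clog_lt_self (by norm_num : 1 < 2 ^ 20) h
        have h2 := Nat.clog_pos (by norm_num : 1 < 2 ^ 20) h
        obtain ⟨l, hl⟩ : ∃ l, Nat.clog (2 ^ 20) (c * N) = l + 1 := ⟨_, (Nat.succ_pred_eq_of_pos h2).symm⟩
        rw [hl] at h1 ⊢
        simp only [Nat.pred_succ, Nat.add_sub_cancel] at h1
        calc (2 ^ (l + 1 + 4)) ^ 20 = 2 ^ 100 * (2 ^ 20) ^ l := by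
              rw [← pow_mul, ← pow_mul, ← pow_add]; congr 1; ring
          _ ≤ 2 ^ 100 * (c * N) := Nat.mul_le_mul_left _ h1.le
          _ = _ := by rw [hB]; ring
      · have : c * N = 1 := by omega
        rw [hB, mul_assoc, this, Nat.clog_one_right]
        norm_num
  obtain ⟨M, rfl⟩ := h4
  obtain ⟨e, T, hT, hM⟩ := Nat.exists_eq_two_pow_mul_odd (n := M) (by omega)
  by_cases hej : j ≤ e
  · refine ⟨4 * M, 0, hN, by omega, by simp, ?_⟩
    have e1 : 4 * M = 2 ^ j * (4 * (2 ^ (e - j) * T)) := by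
      rw [hM]; conv_lhs => rw [show e = j + (e - j) by omega, pow_add]
      ring
    have hpos : 1 ≤ 4 * (2 ^ (e - j) * T) := by
      by_contra! h
      have : 4 * (2 ^ (e - j) * T) = 0 := by omega
      rw [this] at e1; omega
    have hh : IsHad (4 * M) := by
      rw [e1]
      refine hd _ hpos j (le_trans ?_ hj1)
      refine Nat.mul_le_mul_left _ ?_
      rw [e1]; exact Nat.le_mul_of_pos_left _ (by positivity)
    exact hh.toInt
  · have hT2 : T % 2 = 1 := Nat.odd_iff.1 hT
    obtain ⟨t, m0, ht16, ht2, hm2, hmJ, hdvd⟩ := root_exists' T j hT2 hj4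
    have hej' : 2 ^ e ≤ 2 ^ j := Nat.pow_le_pow_right (by norm_num) (by omega)
    have hJ2 : 2 ∣ 2 ^ j := dvd_pow_self 2 (by omega)
    have hcast : ((2 : ℤ) ^ j) = ((2 ^ j : ℕ) : ℤ) := by push_cast; rfl
    rw [hcast] at hdvd
    have hJpos : 0 < 2 ^ j := by positivity
    by_cases hsmall : 2 * t * (m0 + 2 ^ j) ^ 4 ≤ T
    · obtain ⟨k, hk1, hk2, hk3⟩ := findk t (2 ^ j) m0 T (by omega) hJpos hsmall
      set m := m0 + 2 ^ j * k with hm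
      have hmodd : m % 2 = 1 := by
        obtain ⟨u, hu⟩ := hJ2
        rw [hm, hu, mul_assoc]; omega
      have hJm : 2 ^ j ≤ m := by
        rw [hm]; exact le_trans (Nat.le_mul_of_pos_right _ hk1) (Nat.le_add_left _ _)
      have hdv : 2 ^ j ∣ T - t * m ^ 4 := by
        have hle : t * m ^ 4 ≤ T := by nlinarith
        rw [← Int.natCast_dvd_natCast, Nat.cast_sub hle]
        have e1 : (m : ℤ) ≡ m0 [ZMOD ((2 ^ j : ℕ) : ℤ)] := by
          rw [hm]; push_cast
          exact Int.modEq_iff_dvd.2 ⟨-k, by ring⟩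
        have e2 := (e1.pow 4).mul_left (t : ℤ)
        have e3 := (Int.modEq_iff_dvd.2 hdvd)
        push_cast
        have := Int.modEq_iff_dvd.1 (e2.trans e3)
        push_cast at this
        exact this
      obtain ⟨w, hw⟩ := hdv
      have hmpos : 0 < m := by omega
      have hm4 : 0 < t * m ^ 4 := Nat.mul_pos (by omega) (by positivity)
      have hTw : T = t * m ^ 4 + 2 ^ j * w := by
        have : 2 * t * m ^ 4 = 2 * (t * m ^ 4) := by ring
        omega
      have hwpos : 0 < w := by
        rcases Nat.eq_zero_or_pos w with h | h
        · rw [h] at hTw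
          have : 2 * t * m ^ 4 = 2 * (t * m ^ 4) := by ring
          omega
        · exact h
      have hE : 0 < 2 ^ e := by positivity
      have hsum : 4 * M = 2 ^ e * (4 * (t * m ^ 4)) + 2 ^ j * (4 * (2 ^ e * w)) := by
        rw [hM]; conv_lhs => rw [hTw]
        ring
      have H1 : IsHad (2 ^ e * (4 * (t * m ^ 4))) := (isHad_two_pow e).mul (had_tm t m ht16 ht2 hmodd)
      have H2 : IsHad (2 ^ j * (4 * (2 ^ e * w))) := by
        refine hd _ (by have := Nat.mul_pos hE hwpos; omega) j (le_trans ?_ hj1)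
        refine Nat.mul_le_mul_left _ ?_
        rw [hsum]
        exact le_trans (Nat.le_mul_of_pos_left _ hJpos) (Nat.le_add_left _ _)
      have hle : 2 ^ e * (4 * (t * m ^ 4)) ≤ 2 ^ j * (4 * (2 ^ e * w)) := by
        have h1 : t * m ^ 4 ≤ 2 ^ j * w := by
          have : 2 * t * m ^ 4 = 2 * (t * m ^ 4) := by ring
          omega
        calc 2 ^ e * (4 * (t * m ^ 4)) ≤ 2 ^ e * (4 * (2 ^ j * w)) := by gcongr
          _ = _ := by ring
      refine ⟨2 ^ e * (4 * (t * m ^ 4)), 128 * (2 ^ e * t) * 2 ^ j * m ^ 3, by positivity, ?_, ?_, ?_⟩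
      · -- loss
        generalize 2 ^ j = J at *
        have h1 : (m + J) ^ 4 ≤ m ^ 4 + 32 * J * m ^ 3 := by
          have a1 : J ^ 2 * m ^ 2 ≤ J * m ^ 3 := by
            calc J ^ 2 * m ^ 2 = J * m ^ 2 * J := by ring
              _ ≤ J * m ^ 2 * m := Nat.mul_le_mul_left _ hJm
              _ = _ := by ring
          have a2 : J ^ 3 * m ≤ J * m ^ 3 := by
            calc J ^ 3 * m = J * m * J ^ 2 := by ring
              _ ≤ J * m * m ^ 2 := Nat.mul_le_mul_left _ (Nat.pow_le_pow_left hJm 2)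
              _ = _ := by ring
          have a3 : J ^ 4 ≤ J * m ^ 3 := by
            calc J ^ 4 = J * J ^ 3 := by ring
              _ ≤ J * m ^ 3 := Nat.mul_le_mul_left _ (Nat.pow_le_pow_left hJm 3)
          have a4 : (m + J) ^ 4 = m ^ 4 + 4 * (J * m ^ 3) + 6 * (J ^ 2 * m ^ 2) + 4 * (J ^ 3 * m) + J ^ 4 := by ring
          have a5 : 32 * J * m ^ 3 = 32 * (J * m ^ 3) := by ring
          omega
        have h2 : T ≤ 2 * t * (m ^ 4 + 32 * J * m ^ 3) := hk3.le.trans (Nat.mul_le_mul_left _ h1)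
        calc 4 * M = 4 * 2 ^ e * T := by rw [hM]; ring
          _ ≤ 4 * 2 ^ e * (2 * t * (m ^ 4 + 32 * J * m ^ 3)) := Nat.mul_le_mul_left _ h2
          _ = 2 * (2 ^ e * (4 * (t * m ^ 4))) + 2 * (128 * (2 ^ e * t) * J * m ^ 3) := by ring
      · have hYm : (2 ^ e * t) * m ^ 4 ≤ 4 * M := by
          rw [hsum]
          have : 2 ^ e * (4 * (t * m ^ 4)) = 4 * ((2 ^ e * t) * m ^ 4) := by ring
          omega
        have hY : 2 ^ e * t ≤ 15 * 2 ^ j := by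
          calc 2 ^ e * t ≤ 2 ^ j * 15 := Nat.mul_le_mul hej' (by omega)
            _ = _ := by ring
        generalize 4 * M = N at *
        generalize 2 ^ e * t = Y at *
        generalize 2 ^ j = J at *
        have d4 : (128 * Y * J * m ^ 3) ^ 4 ≤ 128 ^ 4 * 15 * (N ^ 3 * J ^ 5) := by
          calc (128 * Y * J * m ^ 3) ^ 4 = 128 ^ 4 * ((Y * m ^ 4) ^ 3 * Y * J ^ 4) := by ring
            _ ≤ 128 ^ 4 * (N ^ 3 * (15 * J) * J ^ 4) := by gcongr
            _ = _ := by ring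
        calc (128 * Y * J * m ^ 3) ^ 16 = ((128 * Y * J * m ^ 3) ^ 4) ^ 4 := by rw [← pow_mul]
          _ ≤ (128 ^ 4 * 15 * (N ^ 3 * J ^ 5)) ^ 4 := Nat.pow_le_pow_left d4 4
          _ = (128 ^ 4 * 15) ^ 4 * N ^ 12 * J ^ 20 := by
            generalize 128 ^ 4 * 15 = z; ring
          _ ≤ (128 ^ 4 * 15) ^ 4 * N ^ 12 * (B * N) := Nat.mul_le_mul_left _ hj2
          _ = (128 ^ 4 * 15) ^ 4 * B * N ^ 13 := by
            generalize (128 ^ 4 * 15) ^ 4 = z; ring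
          _ ≤ _ := by
            refine Nat.mul_le_mul_right _ (Nat.mul_le_mul_right _ (Nat.le_add_left _ _))
      · have key := combine hle H1 H2
        unfold PHM
        rw [hsum]
        exact key
    · refine ⟨1, 4 * M, one_pos, by omega, ?_, phm_one _⟩
      have hTle : T ≤ 480 * (2 ^ j) ^ 4 := by
        calc T ≤ 2 * t * (m0 + 2 ^ j) ^ 4 := by omega
          _ ≤ 2 * 15 * (2 ^ j + 2 ^ j) ^ 4 := by
            refine Nat.mul_le_mul (by omega) (Nat.pow_le_pow_left (by omega) 4)
          _ = _ := by ring
      have hNle : 4 * M ≤ 1920 * (2 ^ j) ^ 5 := by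
        calc 4 * M = 4 * (2 ^ e * T) := by rw [hM]
          _ ≤ 4 * (2 ^ j * (480 * (2 ^ j) ^ 4)) := by gcongr
          _ = _ := by ring
      generalize 4 * M = N at *
      generalize 2 ^ j = J at *
      have h4 : N ^ 4 ≤ 1920 ^ 4 * (B * N) := by
        calc N ^ 4 ≤ (1920 * J ^ 5) ^ 4 := Nat.pow_le_pow_left hNle 4
          _ = 1920 ^ 4 * J ^ 20 := by ring
          _ ≤ _ := Nat.mul_le_mul_left _ hj2
      calc N ^ 16 = N ^ 4 * N ^ 12 := by ring
        _ ≤ 1920 ^ 4 * (B * N) * N ^ 12 := Nat.mul_le_mul_right _ h4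
        _ = 1920 ^ 4 * B * N ^ 13 := by generalize 1920 ^ 4 = z; ring
        _ ≤ _ := by
            refine Nat.mul_le_mul_right _ (Nat.mul_le_mul_right _ (Nat.le_add_right _ _))
end PH

theorem partial_hadamard_unconditional :
    ∀ ε : ℝ, 0 < ε → ∃ C : ℝ, 0 < C ∧ ∀ N : ℕ, 0 < N → 4 ∣ N →
      ∃ R : ℕ, 0 < R ∧ (N : ℝ) / 2 - C * (N : ℝ) ^ ((113 : ℝ)/132 + ε) ≤ (R : ℝ) ∧
        ∃ H : Matrix (Fin R) (Fin N) ℤ,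
          (∀ i j, H i j = 1 ∨ H i j = -1) ∧
          H * H.transpose = (N : ℤ) • (1 : Matrix (Fin R) (Fin R) ℤ) := by
  intro ε hε
  obtain ⟨A, hA⟩ := PH.core
  refine ⟨(A : ℝ) + 1, by positivity, fun N hN h4 => ?_⟩
  obtain ⟨R, D, hR, h1, h2, hH⟩ := hA N hN h4
  refine ⟨R, hR, ?_, hH⟩
  have hN1 : (1 : ℝ) ≤ N := by exact_mod_cast hN
  have hN0 : (0 : ℝ) ≤ N := by linarith
  have hD : (D : ℝ) ≤ (A + 1) * (N : ℝ) ^ ((13 : ℝ) / 16) := by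
    have h3 : (D : ℝ) ^ 16 ≤ ((A + 1) * (N : ℝ) ^ ((13 : ℝ) / 16)) ^ 16 := by
      have e : ((N : ℝ) ^ ((13 : ℝ) / 16)) ^ 16 = (N : ℝ) ^ 13 := by
        rw [← Real.rpow_natCast, ← Real.rpow_mul hN0, ← Real.rpow_natCast]
        norm_num
      rw [mul_pow, e]
      have h5 : (D : ℝ) ^ 16 ≤ A * (N : ℝ) ^ 13 := by exact_mod_cast h2
      refine h5.trans (mul_le_mul_of_nonneg_right ?_ (by positivity))
      have hA0 : (0 : ℝ) ≤ A := Nat.cast_nonneg _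
      have : (A : ℝ) + 1 ≤ (A + 1) ^ 16 := le_self_pow₀ (by linarith) (by norm_num)
      linarith
    exact le_of_pow_le_pow_left₀ (by norm_num) (by positivity) h3
  have hpow : (N : ℝ) ^ ((13 : ℝ) / 16) ≤ (N : ℝ) ^ ((113 : ℝ)/132 + ε) :=
    Real.rpow_le_rpow_of_exponent_le hN1 (by norm_num; linarith)
  have h6 : (N : ℝ) ≤ 2 * R + 2 * D := by exact_mod_cast h1
  have h7 : ((A : ℝ) + 1) * (N : ℝ) ^ ((13 : ℝ) / 16) ≤ (A + 1) * (N : ℝ) ^ ((113 : ℝ)/132 + ε) :=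
    mul_le_mul_of_nonneg_left hpow (by positivity)
  linarith
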